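/- arXiv:1806.08806 — 4 statements merged into one kernel-verified Lean document; each statement's English description precedes it below -/
import Mathlib

section
/- Let X and Y be sets, k a natural number, and R ⊆ X × Y a k-stable relation. Let 𝒜_R be the Boolean algebra of subsets of X generated by the fibers R_b = {x ∈ X : (x,b) ∈ R} for b ∈ Y. Then every finitely additive probability measure μ on 𝒜_R is a countable weighted sum of ultrafilters: there exist a finite or countably infinite family (p_i)_{i∈I} of ultrafilters on 𝒜_R and positive real numbers (α_i)_{i∈I} with Σ_{i∈I} α_i = 1 such that μ(A) = Σ_{i∈I} α_i·p_i(A) for every A ∈ 𝒜_R. -/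
/-!
STATEMENT 0: If `R ⊆ X × Y` is a `k`-stable relation, then every finitely additive
probability measure on the Boolean algebra of subsets of `X` generated by the fibers
`R_b = {x | R x b}` is a countable weighted sum of ultrafilters on that algebra.
-/

/-- `R` is `k`-stable: there is no half-graph of height `k`. -/
def IsKStable {X Y : Type*} (R : X → Y → Prop) (k : ℕ) : Prop :=
  ¬∃ (a : Fin k → X) (b : Fin k → Y), ∀ i j, R (a i) (b j) ↔ i ≤ j

/-- The Boolean algebra of subsets of `X` generated by a family `S` of subsets:
the smallest collection containing `S` and `X` and closed under complementation
and finite intersection. -/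
inductive GenBoolAlg {X : Type*} (S : Set (Set X)) : Set X → Prop
  | basic {A : Set X} : A ∈ S → GenBoolAlg S A
  | univ : GenBoolAlg S Set.univ
  | compl {A : Set X} : GenBoolAlg S A → GenBoolAlg S Aᶜ
  | inter {A B : Set X} : GenBoolAlg S A → GenBoolAlg S B → GenBoolAlg S (A ∩ B)

/-- `μ` is a finitely additive probability measure on the algebra `𝒜` of subsets of `X`. -/
def IsFinAddProb {X : Type*} (𝒜 : Set (Set X)) (μ : Set X → ℝ) : Prop :=
  (∀ A ∈ 𝒜, 0 ≤ μ A) ∧ μ Set.univ = 1 ∧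
    ∀ A ∈ 𝒜, ∀ B ∈ 𝒜, Disjoint A B → μ (A ∪ B) = μ A + μ B

/-- An ultrafilter on the algebra `𝒜`, viewed as a `{0,1}`-valued finitely additive
probability measure on `𝒜`. -/
def IsUltraOn {X : Type*} (𝒜 : Set (Set X)) (p : Set X → ℝ) : Prop :=
  IsFinAddProb 𝒜 p ∧ ∀ A ∈ 𝒜, p A = 0 ∨ p A = 1

/-- The Boolean algebra of subsets of `X` generated by the fibers `R_b`, `b ∈ Y`. -/
def fiberAlgebra {X Y : Type*} (R : X → Y → Prop) : Set (Set X) :=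
  {A | GenBoolAlg {s | ∃ b : Y, s = {x | R x b}} A}

open MeasureTheory

/-- A nonnegative finitely additive set function on a collection `𝒜` of subsets of `X`. -/
def IsFinAddOn {X : Type*} (𝒜 : Set (Set X)) (ν : Set X → ℝ) : Prop :=
  (∀ A ∈ 𝒜, 0 ≤ ν A) ∧ ∀ A ∈ 𝒜, ∀ B ∈ 𝒜, Disjoint A B → ν (A ∪ B) = ν A + ν B

theorem IsFinAddProb.isFinAddOn {X : Type*} {𝒜 : Set (Set X)} {μ : Set X → ℝ}
    (h : IsFinAddProb 𝒜 μ) : IsFinAddOn 𝒜 μ := ⟨h.1, h.2.2⟩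

theorem isSetAlgebra_fiberAlgebra {X Y : Type*} (R : X → Y → Prop) :
    IsSetAlgebra (fiberAlgebra R) where
  empty_mem := by
    have h : GenBoolAlg {s | ∃ b : Y, s = {x | R x b}} (Set.univᶜ : Set X) :=
      GenBoolAlg.univ.compl
    rwa [Set.compl_univ] at h
  compl_mem _ h := GenBoolAlg.compl h
  union_mem A B hA hB := by
    have h := ((GenBoolAlg.compl hA).inter (GenBoolAlg.compl hB)).compl
    rwa [Set.compl_inter, compl_compl, compl_compl] at h

theorem fiber_mem_fiberAlgebra {X Y : Type*} (R : X → Y → Prop) (b : Y) :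
    {x | R x b} ∈ fiberAlgebra R := GenBoolAlg.basic ⟨b, rfl⟩

namespace IsFinAddOn

variable {X : Type*} {𝒜 : Set (Set X)} {ν : Set X → ℝ}

theorem empty (h : IsFinAddOn 𝒜 ν) (h𝒜 : IsSetAlgebra 𝒜) : ν ∅ = 0 := by
  have := h.2 ∅ h𝒜.empty_mem ∅ h𝒜.empty_mem (Set.disjoint_empty ∅)
  rw [Set.union_empty] at this
  linarith

theorem inter_add_diff (h : IsFinAddOn 𝒜 ν) (h𝒜 : IsSetAlgebra 𝒜) {A B : Set X}
    (hA : A ∈ 𝒜) (hB : B ∈ 𝒜) : ν (A ∩ B) + ν (A \ B) = ν A := by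
  rw [← h.2 _ (h𝒜.inter_mem hA hB) _ (h𝒜.sdiff_mem hA hB)
    (Set.disjoint_sdiff_right.mono_left Set.inter_subset_right), Set.inter_union_sdiff]

theorem add_compl (h : IsFinAddOn 𝒜 ν) (h𝒜 : IsSetAlgebra 𝒜) {A : Set X} (hA : A ∈ 𝒜) :
    ν A + ν Aᶜ = ν Set.univ := by
  have := h.inter_add_diff h𝒜 h𝒜.univ_mem hA
  rwa [Set.univ_inter, ← Set.compl_eq_univ_sdiff] at this

theorem mono (h : IsFinAddOn 𝒜 ν) (h𝒜 : IsSetAlgebra 𝒜) {A B : Set X}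
    (hA : A ∈ 𝒜) (hB : B ∈ 𝒜) (hAB : A ⊆ B) : ν A ≤ ν B := by
  have h1 := h.inter_add_diff h𝒜 hB hA
  rw [Set.inter_eq_self_of_subset_right hAB] at h1
  linarith [h.1 _ (h𝒜.sdiff_mem hB hA)]

end IsFinAddOn

section Splitting

variable {X Y : Type*} (R : X → Y → Prop) (𝒜 : Set (Set X)) (ν : Set X → ℝ)

/-- `A` has positive measure, and so do both parts into which the fiber over some `b ∈ B`
cuts any positive subset of `A`. -/
def HereditarilySplit (A : Set X) (B : Set Y) : Prop :=
  A ∈ 𝒜 ∧ 0 < ν A ∧ ∀ A' ∈ 𝒜, A' ⊆ A → 0 < ν A' →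
    ∃ b ∈ B, 0 < ν (A' ∩ {x | R x b}) ∧ 0 < ν (A' \ {x | R x b})

variable {R 𝒜 ν}

theorem HereditarilySplit.mono {A A' : Set X} {B : Set Y} (h : HereditarilySplit R 𝒜 ν A B)
    (hA' : A' ∈ 𝒜) (hsub : A' ⊆ A) (hpos : 0 < ν A') : HereditarilySplit R 𝒜 ν A' B :=
  ⟨hA', hpos, fun A'' hA'' hs => h.2.2 A'' hA'' (hs.trans hsub)⟩

theorem HereditarilySplit.exists_partition (h𝒜 : IsSetAlgebra 𝒜) (hν : IsFinAddOn 𝒜 ν)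
    (hfib : ∀ b, {x | R x b} ∈ 𝒜) {A : Set X} {B : Set Y}
    (h : HereditarilySplit R 𝒜 ν A B) (C : Set Y) :
    ∃ A' ⊆ A, HereditarilySplit R 𝒜 ν A' (B ∩ C) ∨ HereditarilySplit R 𝒜 ν A' (B \ C) := by
  by_cases hC : HereditarilySplit R 𝒜 ν A (B ∩ C)
  · exact ⟨A, subset_rfl, Or.inl hC⟩
  have hC' : ∃ A₁ ∈ 𝒜, A₁ ⊆ A ∧ 0 < ν A₁ ∧ ∀ b ∈ B ∩ C,
      ¬(0 < ν (A₁ ∩ {x | R x b}) ∧ 0 < ν (A₁ \ {x | R x b})) := by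
    by_contra hne
    refine hC ⟨h.1, h.2.1, fun A₁ h₁ hs hpos => ?_⟩
    by_contra hb
    exact hne ⟨A₁, h₁, hs, hpos, fun b hbB hsplit => hb ⟨b, hbB, hsplit⟩⟩
  obtain ⟨A₁, h₁, hs₁, hpos₁, hno⟩ := hC'
  refine ⟨A₁, hs₁, Or.inr ⟨h₁, hpos₁, fun A₂ h₂ hs₂ hpos₂ => ?_⟩⟩
  obtain ⟨b, hb, hin, hout⟩ := h.2.2 A₂ h₂ (hs₂.trans hs₁) hpos₂
  refine ⟨b, ⟨hb, fun hbC => hno b ⟨hb, hbC⟩ ⟨?_, ?_⟩⟩, hin, hout⟩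
  · exact hin.trans_le (hν.mono h𝒜 (h𝒜.inter_mem h₂ (hfib b)) (h𝒜.inter_mem h₁ (hfib b))
      (Set.inter_subset_inter_left _ hs₂))
  · exact hout.trans_le (hν.mono h𝒜 (h𝒜.sdiff_mem h₂ (hfib b)) (h𝒜.sdiff_mem h₁ (hfib b))
      (Set.sdiff_subset_sdiff_left hs₂))

theorem HereditarilySplit.exists_halfGraph (h𝒜 : IsSetAlgebra 𝒜) (hν : IsFinAddOn 𝒜 ν)
    (hfib : ∀ b, {x | R x b} ∈ 𝒜) (n : ℕ) {A : Set X} {B : Set Y}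
    (h : HereditarilySplit R 𝒜 ν A B) :
    ∃ (a : ℕ → X) (b : ℕ → Y), (∀ i ≤ n, a i ∈ A) ∧ (∀ j < n, b j ∈ B) ∧
      ∀ i ≤ n, ∀ j < n, (R (a i) (b j) ↔ i ≤ j) := by
  have hne : ∃ x, x ∈ A := by
    rw [← Set.Nonempty, Set.nonempty_iff_ne_empty]
    rintro rfl
    exact h.2.1.ne' (hν.empty h𝒜)
  obtain ⟨x, hx⟩ := hne
  induction n generalizing A B x with
  | zero =>
    obtain ⟨y, -⟩ := h.2.2 A h.1 subset_rfl h.2.1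
    exact ⟨fun _ => x, fun _ => y, by simp [hx], by simp, by simp⟩
  | succ n ih =>
    have ih' : ∀ {A' : Set X} {B' : Set Y}, HereditarilySplit R 𝒜 ν A' B' →
        ∃ (a : ℕ → X) (b : ℕ → Y), (∀ i ≤ n, a i ∈ A') ∧ (∀ j < n, b j ∈ B') ∧
          ∀ i ≤ n, ∀ j < n, (R (a i) (b j) ↔ i ≤ j) := by
      intro A' B' h'
      have hne : A'.Nonempty := by
        rw [Set.nonempty_iff_ne_empty]
        rintro rfl
        exact h'.2.1.ne' (hν.empty h𝒜)
      exact ih h' hne.some hne.some_mem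
    obtain ⟨A', hsub, hA' | hA'⟩ := h.exists_partition h𝒜 hν hfib {y | R x y}
    · obtain ⟨y, hy, -, hout⟩ := hA'.2.2 A' hA'.1 subset_rfl hA'.2.1
      obtain ⟨a, b, ha, hb, hab⟩ := ih' (hA'.mono (h𝒜.sdiff_mem hA'.1 (hfib y))
        Set.sdiff_subset hout)
      refine ⟨fun i => i.casesOn x a, fun j => j.casesOn y b, ?_, ?_, ?_⟩
      · rintro (_ | i) hi
        · exact hx
        · exact hsub (ha i (by omega)).1
      · rintro (_ | j) hj
        · exact hy.1
        · exact (hb j (by omega)).1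
      · rintro (_ | i) hi (_ | j) hj
        · simpa using hy.2
        · simpa using (hb j (by omega)).2
        · simpa using (ha i (by omega)).2
        · simpa using hab i (by omega) j (by omega)
    · obtain ⟨y, hy, hin, -⟩ := hA'.2.2 A' hA'.1 subset_rfl hA'.2.1
      obtain ⟨a, b, ha, hb, hab⟩ := ih' (hA'.mono (h𝒜.inter_mem hA'.1 (hfib y))
        Set.inter_subset_left hin)
      refine ⟨fun i => if i ≤ n then a i else x, fun j => if j < n then b j else y, ?_, ?_, ?_⟩
      · intro i hi
        dsimp only
        split_ifs with hin
        · exact hsub (ha i hin).1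
        · exact hx
      · intro j hj
        dsimp only
        split_ifs with hjn
        · exact (hb j hjn).1
        · exact hy.1
      · intro i hi j hj
        dsimp only
        split_ifs with hin hjn hjn
        · exact hab i hin j hjn
        · exact iff_of_true (ha i hin).2 (by omega)
        · exact iff_of_false (hb j hjn).2 (by omega)
        · exact iff_of_false hy.2 (by omega)

end Splitting

/-- Stability yields a set of positive measure which no fiber cuts into two positive parts. -/
theorem IsKStable.exists_unsplit {X Y : Type*} {k : ℕ} {R : X → Y → Prop} (hR : IsKStable R k)
    {ν : Set X → ℝ} (hν : IsFinAddOn (fiberAlgebra R) ν) (hpos : 0 < ν Set.univ) :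
    ∃ A ∈ fiberAlgebra R, 0 < ν A ∧ ∀ b, ν (A ∩ {x | R x b}) = 0 ∨ ν (A \ {x | R x b}) = 0 := by
  have h𝒜 := isSetAlgebra_fiberAlgebra R
  by_contra hno
  have hsplit : HereditarilySplit R (fiberAlgebra R) ν Set.univ Set.univ := by
    refine ⟨h𝒜.univ_mem, hpos, fun A hA _ hApos => ?_⟩
    by_contra hb
    refine hno ⟨A, hA, hApos, fun b => ?_⟩
    by_contra! hne
    have hfib := fiber_mem_fiberAlgebra R b
    exact hb ⟨b, trivial, (hν.1 _ (h𝒜.inter_mem hA hfib)).lt_of_ne' hne.1,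
      (hν.1 _ (h𝒜.sdiff_mem hA hfib)).lt_of_ne' hne.2⟩
  obtain ⟨a, b, -, -, hab⟩ := hsplit.exists_halfGraph h𝒜 hν (fiber_mem_fiberAlgebra R) k
  exact hR ⟨fun i => a i, fun j => b j, fun i j => hab i i.2.le j j.2⟩

/-- A set which no generator cuts into two positive parts is not cut by the whole algebra. -/
theorem unsplit_of_mem_fiberAlgebra {X Y : Type*} {R : X → Y → Prop} {ν : Set X → ℝ}
    (hν : IsFinAddOn (fiberAlgebra R) ν) {A : Set X} (hA : A ∈ fiberAlgebra R)
    (h : ∀ b, ν (A ∩ {x | R x b}) = 0 ∨ ν (A \ {x | R x b}) = 0) {B : Set X}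
    (hB : B ∈ fiberAlgebra R) : ν (A ∩ B) = 0 ∨ ν (A \ B) = 0 := by
  have h𝒜 := isSetAlgebra_fiberAlgebra R
  induction hB with
  | basic hB =>
    obtain ⟨b, rfl⟩ := hB
    exact h b
  | univ => simp [hν.empty h𝒜]
  | compl hB ih =>
    rw [Set.sdiff_compl, ← Set.sdiff_eq]
    exact ih.symm
  | @inter B C hB hC ihB ihC =>
    have hBC := h𝒜.inter_mem hB hC
    have hzero : ∀ {S T : Set X}, S ∈ fiberAlgebra R → T ∈ fiberAlgebra R → S ⊆ T →
        ν T = 0 → ν S = 0 := fun hS hT hST hT0 =>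
      le_antisymm (hT0 ▸ hν.mono h𝒜 hS hT hST) (hν.1 _ hS)
    rcases ihB with hB0 | hB0
    · exact Or.inl (hzero (h𝒜.inter_mem hA hBC) (h𝒜.inter_mem hA hB)
        (Set.inter_subset_inter_right _ Set.inter_subset_left) hB0)
    rcases ihC with hC0 | hC0
    · exact Or.inl (hzero (h𝒜.inter_mem hA hBC) (h𝒜.inter_mem hA hC)
        (Set.inter_subset_inter_right _ Set.inter_subset_right) hC0)
    right
    have hABC := h𝒜.sdiff_mem hA hBC
    have hsplit := hν.inter_add_diff h𝒜 hABC hB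
    have h1 : ν ((A \ (B ∩ C)) ∩ B) = 0 :=
      hzero (h𝒜.inter_mem hABC hB) (h𝒜.sdiff_mem hA hC)
        (fun x hx => ⟨hx.1.1, fun hxC => hx.1.2 ⟨hx.2, hxC⟩⟩) hC0
    have h2 : ν ((A \ (B ∩ C)) \ B) = 0 :=
      hzero (h𝒜.sdiff_mem hABC hB) (h𝒜.sdiff_mem hA hB) (fun x hx => ⟨hx.1.1, hx.2⟩) hB0
    linarith

/-- The ultrafilters on `𝒜`, extended by `0` outside `𝒜` so that they are determined by their
values on `𝒜`. -/
def ultraSpace {X : Type*} (𝒜 : Set (Set X)) : Set (Set X → ℝ) :=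
  {p | IsUltraOn 𝒜 p ∧ ∀ A ∉ 𝒜, p A = 0}

/-- The mass of the atom of `μ` at the ultrafilter `p`. -/
noncomputable def atomMass {X : Type*} (𝒜 : Set (Set X)) (μ p : Set X → ℝ) : ℝ :=
  sInf {r | ∃ A ∈ 𝒜, p A = 1 ∧ r = μ A}

open Classical in
theorem IsKStable.exists_ultra_le {X Y : Type*} {k : ℕ} {R : X → Y → Prop} (hR : IsKStable R k)
    {ν : Set X → ℝ} (hν : IsFinAddOn (fiberAlgebra R) ν) (hpos : 0 < ν Set.univ) :
    ∃ q ∈ ultraSpace (fiberAlgebra R), ∃ c > 0, ∀ A ∈ fiberAlgebra R, c * q A ≤ ν A := by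
  have h𝒜 := isSetAlgebra_fiberAlgebra R
  obtain ⟨A, hA, hApos, hsplit⟩ := hR.exists_unsplit hν hpos
  refine ⟨fun B => if B ∈ fiberAlgebra R then ν (A ∩ B) / ν A else 0,
    ⟨⟨⟨fun B hB => ?_, ?_, fun B hB C hC hBC => ?_⟩, fun B hB => ?_⟩, fun B hB => if_neg hB⟩,
    ν A, hApos, fun B hB => ?_⟩
  all_goals dsimp only
  · rw [if_pos hB]
    exact div_nonneg (hν.1 _ (h𝒜.inter_mem hA hB)) hApos.le
  · rw [if_pos h𝒜.univ_mem, Set.inter_univ, div_self hApos.ne']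
  · rw [if_pos hB, if_pos hC, if_pos (h𝒜.union_mem hB hC), Set.inter_union_distrib_left,
      hν.2 _ (h𝒜.inter_mem hA hB) _ (h𝒜.inter_mem hA hC)
        (hBC.mono Set.inter_subset_right Set.inter_subset_right), add_div]
  · rw [if_pos hB]
    have hadd := hν.inter_add_diff h𝒜 hA hB
    rcases unsplit_of_mem_fiberAlgebra hν hA hsplit hB with h0 | h0
    · left
      rw [h0, zero_div]
    · right
      rw [show ν (A ∩ B) = ν A by linarith, div_self hApos.ne']
  · rw [if_pos hB, mul_div_cancel₀ _ hApos.ne']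
    exact hν.mono h𝒜 (h𝒜.inter_mem hA hB) hB Set.inter_subset_right

section Atoms

variable {X : Type*} {𝒜 : Set (Set X)} {μ : Set X → ℝ}

theorem atomMass_le (hμ : IsFinAddOn 𝒜 μ) {p : Set X → ℝ} {A : Set X} (hA : A ∈ 𝒜)
    (hpA : p A = 1) : atomMass 𝒜 μ p ≤ μ A :=
  csInf_le ⟨0, by rintro r ⟨B, hB, -, rfl⟩; exact hμ.1 B hB⟩ ⟨A, hA, hpA, rfl⟩

theorem le_atomMass (h𝒜 : IsSetAlgebra 𝒜) {p : Set X → ℝ} (hp : p Set.univ = 1) {c : ℝ}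
    (hc : ∀ A ∈ 𝒜, p A = 1 → c ≤ μ A) : c ≤ atomMass 𝒜 μ p :=
  le_csInf ⟨_, Set.univ, h𝒜.univ_mem, hp, rfl⟩ (by rintro r ⟨B, hB, hpB, rfl⟩; exact hc B hB hpB)

theorem atomMass_nonneg (hμ : IsFinAddOn 𝒜 μ) (p : Set X → ℝ) : 0 ≤ atomMass 𝒜 μ p :=
  Real.sInf_nonneg (by rintro r ⟨B, hB, -, rfl⟩; exact hμ.1 B hB)

theorem IsUltraOn.inter_eq_one (h𝒜 : IsSetAlgebra 𝒜) {p : Set X → ℝ} (hp : IsUltraOn 𝒜 p)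
    {A B : Set X} (hA : A ∈ 𝒜) (hB : B ∈ 𝒜) (hpA : p A = 1) (hpB : p B = 1) :
    p (A ∩ B) = 1 := by
  have hfin := hp.1.isFinAddOn
  have h1 := hfin.inter_add_diff h𝒜 hA hB
  have h2 := hfin.add_compl h𝒜 hB
  have h3 := hfin.mono h𝒜 (h𝒜.sdiff_mem hA hB) (h𝒜.compl_mem hB) fun x hx => hx.2
  have h4 := hfin.1 _ (h𝒜.sdiff_mem hA hB)
  have h5 := hp.1.2.1
  linarith

theorem exists_separating (h𝒜 : IsSetAlgebra 𝒜) {p q : Set X → ℝ} (hp : p ∈ ultraSpace 𝒜)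
    (hq : q ∈ ultraSpace 𝒜) (hpq : p ≠ q) : ∃ A ∈ 𝒜, q A = 1 ∧ p A = 0 := by
  by_contra hno
  have hle : ∀ A ∈ 𝒜, q A = 1 → p A = 1 := fun A hA hqA =>
    (hp.1.2 A hA).resolve_left fun h0 => hno ⟨A, hA, hqA, h0⟩
  refine hpq (funext fun A => ?_)
  by_cases hA : A ∈ 𝒜
  · rcases hq.1.2 A hA with h0 | h1
    · have hqc := hq.1.1.isFinAddOn.add_compl h𝒜 hA
      have hpc := hp.1.1.isFinAddOn.add_compl h𝒜 hA
      rw [hq.1.1.2.1] at hqc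
      rw [hp.1.1.2.1, hle _ (h𝒜.compl_mem hA) (by linarith)] at hpc
      linarith
    · rw [h1, hle A hA h1]
  · rw [hp.2 A hA, hq.2 A hA]

theorem exists_separating_finset (h𝒜 : IsSetAlgebra 𝒜) {q : ultraSpace 𝒜}
    (F : Finset (ultraSpace 𝒜)) (hq : q ∉ F) :
    ∃ A ∈ 𝒜, q.1 A = 1 ∧ ∀ p ∈ F, p.1 A = 0 := by
  classical
  induction F using Finset.induction_on with
  | empty => exact ⟨Set.univ, h𝒜.univ_mem, q.2.1.1.2.1, by simp⟩
  | insert p F hpF ih =>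
    rw [Finset.mem_insert, not_or] at hq
    obtain ⟨A, hA, hqA, hFA⟩ := ih hq.2
    obtain ⟨B, hB, hqB, hpB⟩ := exists_separating h𝒜 p.2 q.2
      fun h => hq.1 (Subtype.ext h).symm
    have hAB := h𝒜.inter_mem hA hB
    refine ⟨A ∩ B, hAB, q.2.1.inter_eq_one h𝒜 hA hB hqA hqB, fun r hr => ?_⟩
    have hr0 : ∀ {C}, C ∈ 𝒜 → A ∩ B ⊆ C → r.1 C = 0 → r.1 (A ∩ B) = 0 := fun hC hs h0 =>
      le_antisymm (h0 ▸ r.2.1.1.isFinAddOn.mono h𝒜 hAB hC hs) (r.2.1.1.1 _ hAB)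
    rcases Finset.mem_insert.1 hr with rfl | hr
    · exact hr0 hB Set.inter_subset_right hpB
    · exact hr0 hA Set.inter_subset_left (hFA r hr)

theorem sum_atomMass_le (h𝒜 : IsSetAlgebra 𝒜) (hμ : IsFinAddOn 𝒜 μ)
    (F : Finset (ultraSpace 𝒜)) {A : Set X} (hA : A ∈ 𝒜) :
    ∑ p ∈ F, atomMass 𝒜 μ p * p.1 A ≤ μ A := by
  classical
  induction F using Finset.induction_on generalizing A with
  | empty => simpa using hμ.1 A hA
  | insert q F hqF ih =>
    rw [Finset.sum_insert hqF]
    rcases q.2.1.2 A hA with h0 | h1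
    · simpa [h0] using ih hA
    · obtain ⟨B, hB, hqB, hFB⟩ := exists_separating_finset h𝒜 F hqF
      have hin : atomMass 𝒜 μ q ≤ μ (A ∩ B) :=
        atomMass_le hμ (h𝒜.inter_mem hA hB) (q.2.1.inter_eq_one h𝒜 hA hB h1 hqB)
      have hout := ih (h𝒜.sdiff_mem hA hB)
      have hsum : ∑ p ∈ F, atomMass 𝒜 μ p * p.1 (A \ B) =
          ∑ p ∈ F, atomMass 𝒜 μ p * p.1 A := by
        refine Finset.sum_congr rfl fun p hp => ?_
        have hfin := p.2.1.1.isFinAddOn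
        have hadd := hfin.inter_add_diff h𝒜 hA hB
        have hle := hfin.mono h𝒜 (h𝒜.inter_mem hA hB) hB Set.inter_subset_right
        rw [hFB p hp] at hle
        rw [show p.1 (A \ B) = p.1 A by linarith [hfin.1 _ (h𝒜.inter_mem hA hB)]]
      rw [h1, mul_one]
      linarith [hμ.inter_add_diff h𝒜 hA hB]

theorem summable_atomMass (h𝒜 : IsSetAlgebra 𝒜) (hμ : IsFinAddOn 𝒜 μ) {A : Set X}
    (hA : A ∈ 𝒜) : Summable fun p : ultraSpace 𝒜 => atomMass 𝒜 μ p * p.1 A :=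
  summable_of_sum_le (fun p => mul_nonneg (atomMass_nonneg hμ p) (p.2.1.1.1 A hA))
    fun F => sum_atomMass_le h𝒜 hμ F hA

theorem isFinAddOn_sub_tsum_atomMass (h𝒜 : IsSetAlgebra 𝒜) (hμ : IsFinAddOn 𝒜 μ) :
    IsFinAddOn 𝒜 fun A => μ A - ∑' p : ultraSpace 𝒜, atomMass 𝒜 μ p * p.1 A := by
  refine ⟨fun A hA => sub_nonneg.2 ((summable_atomMass h𝒜 hμ hA).tsum_le_of_sum_le
    fun F => sum_atomMass_le h𝒜 hμ F hA), fun A hA B hB hAB => ?_⟩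
  have hsum : ∑' p : ultraSpace 𝒜, atomMass 𝒜 μ p * p.1 (A ∪ B) =
      ∑' p : ultraSpace 𝒜, (atomMass 𝒜 μ p * p.1 A + atomMass 𝒜 μ p * p.1 B) :=
    tsum_congr fun p => by rw [p.2.1.1.2.2 A hA B hB hAB, mul_add]
  dsimp only
  rw [hsum, (summable_atomMass h𝒜 hμ hA).tsum_add (summable_atomMass h𝒜 hμ hB),
    hμ.2 A hA B hB hAB]
  ring

end Atoms

theorem IsKStable.hasSum_atomMass {X Y : Type*} {k : ℕ} {R : X → Y → Prop}
    (hR : IsKStable R k) {μ : Set X → ℝ} (hμ : IsFinAddOn (fiberAlgebra R) μ) {A : Set X}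
    (hA : A ∈ fiberAlgebra R) :
    HasSum (fun p : ultraSpace (fiberAlgebra R) => atomMass (fiberAlgebra R) μ p * p.1 A)
      (μ A) := by
  have h𝒜 := isSetAlgebra_fiberAlgebra R
  have hρ := isFinAddOn_sub_tsum_atomMass h𝒜 hμ
  rw [(summable_atomMass h𝒜 hμ hA).hasSum_iff]
  refine (sub_eq_zero.1 (le_antisymm ((hρ.mono h𝒜 hA h𝒜.univ_mem (Set.subset_univ A)).trans ?_)
    (hρ.1 A hA))).symm
  by_contra! hpos
  obtain ⟨q, hq, c, hc, hle⟩ := hR.exists_ultra_le hρ hpos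
  have hmass : atomMass (fiberAlgebra R) μ q + c ≤ atomMass (fiberAlgebra R) μ q := by
    refine le_atomMass h𝒜 hq.1.1.2.1 fun B hB hqB => ?_
    have h1 := hle B hB
    have h2 := (summable_atomMass h𝒜 hμ hB).le_tsum ⟨q, hq⟩
      fun p _ => mul_nonneg (atomMass_nonneg hμ p) (p.2.1.1.1 B hB)
    dsimp only at h1 h2
    rw [hqB, mul_one] at h1 h2
    linarith
  linarith

/-- A summable family is reindexed by a countable type in `Type` that enumerates its support. -/
theorem Summable.exists_countable_reindex {W : Type*} {m : W → ℝ} (hm : Summable m) :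
    ∃ (I : Type) (_ : Countable I) (e : I → W), (∀ i, m (e i) ≠ 0) ∧
      ∀ (g : W → ℝ) (s : ℝ), Function.support g ⊆ Function.support m → HasSum g s →
        HasSum (fun i => g (e i)) s := by
  have hcount : Countable (Function.support m) := hm.countable_support
  obtain ⟨f, hf⟩ := hcount.exists_injective_nat
  let e : Set.range f ≃ Function.support m := (Equiv.ofInjective f hf).symm
  exact ⟨Set.range f, inferInstance, fun i => (e i).1, fun i => (e i).2, fun g s hg hs =>
    (e.hasSum_iff (f := fun w : Function.support m => g w)).2
      ((hasSum_subtype_iff_of_support_subset hg).2 hs)⟩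

theorem stable_measure_is_countable_sum_of_ultrafilters
    {X Y : Type*} (k : ℕ) (R : X → Y → Prop) (hR : IsKStable R k)
    (μ : Set X → ℝ) (hμ : IsFinAddProb (fiberAlgebra R) μ) :
    ∃ (I : Type) (_ : Countable I) (p : I → Set X → ℝ) (α : I → ℝ),
      (∀ i, IsUltraOn (fiberAlgebra R) (p i)) ∧
      (∀ i, 0 < α i) ∧
      HasSum α 1 ∧
      ∀ A ∈ fiberAlgebra R, HasSum (fun i => α i * p i A) (μ A) := by
  have hfin := hμ.isFinAddOn
  have hsum : ∀ A ∈ fiberAlgebra R, HasSum (fun p : ultraSpace (fiberAlgebra R) =>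
      atomMass (fiberAlgebra R) μ p * p.1 A) (μ A) := fun A hA => hR.hasSum_atomMass hfin hA
  have hone : HasSum (fun p : ultraSpace (fiberAlgebra R) =>
      atomMass (fiberAlgebra R) μ p) 1 := by
    have h := hsum Set.univ (isSetAlgebra_fiberAlgebra R).univ_mem
    rw [hμ.2.1] at h
    simpa only [fun p : ultraSpace (fiberAlgebra R) => p.2.1.1.2.1, mul_one] using h
  obtain ⟨I, hI, e, hne, he⟩ := hone.summable.exists_countable_reindex
  exact ⟨I, hI, fun i => (e i).1, fun i => atomMass (fiberAlgebra R) μ (e i),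
    fun i => (e i).2.1, fun i => (atomMass_nonneg hfin _).lt_of_ne' (hne i),
    he _ _ subset_rfl hone,
    fun A hA => he _ _ (Function.support_mul_subset_left _ _) (hsum A hA)⟩
end

section
/- Let L be a first-order language, M an L-structure, φ(x,y) an L-formula and b ∈ M^{|y|}, and suppose A = φ(M,b) = {a ∈ M : M ⊨ φ(a,b)}. Then A is pseudofinite in M if and only if for every L-formula ψ(y) with M ⊨ ψ(b) there exist an L-structure M' and b' ∈ (M')^{|y|} with M' ⊨ ψ(b') such that the set φ(M',b') = {a ∈ M' : M' ⊨ φ(a,b')} is finite. -/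
open FirstOrder

universe u v w

/-- The language with a single unary relation symbol `P` (and nothing else). -/
def pRels : ℕ → Type
  | 1 => PUnit
  | _ => Empty

def pLang : FirstOrder.Language.{0, 0} :=
  ⟨fun _ => Empty, pRels⟩

/-- The `pLang`-structure on `M` interpreting `P` as the subset `A`. -/
def pStruct (M : Type w) (A : Set M) : pLang.Structure M where
  funMap := fun f _ => f.elim
  RelMap := fun {n} r x =>
    match n, r, x with
    | 1, _, x => x 0 ∈ A

/-- The language `L(P)`: `L` together with a new unary predicate `P`. -/
def LP (L : FirstOrder.Language.{u, v}) : FirstOrder.Language := L.sum pLang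

/-- The `L(P)`-structure `(M, A)`. -/
def lpStruct (L : FirstOrder.Language.{u, v}) (M : Type w) [L.Structure M] (A : Set M) :
    (LP L).Structure M :=
  @Language.sumStructure L pLang M _ (pStruct M A)

/-- `(M, A) ⊨ σ` for an `L(P)`-sentence `σ`. -/
def PSat (L : FirstOrder.Language.{u, v}) (M : Type w) [L.Structure M] (A : Set M)
    (σ : (LP L).Sentence) : Prop :=
  @Language.Sentence.Realize (LP L) M (lpStruct L M A) σ

/-- `A` is pseudofinite in `M`. -/
def IsPseudofiniteIn (L : FirstOrder.Language.{u, v}) (M : Type w) [L.Structure M]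
    (A : Set M) : Prop :=
  ∀ σ : (LP L).Sentence, PSat L M A σ →
    ∃ (M' : Type (max u v w)) (_ : L.Structure M') (A' : Set M'),
      A'.Finite ∧ PSat L M' A' σ

open FirstOrder.Language

namespace LP

variable {L : FirstOrder.Language.{u, v}} {α : Type*} {m n : ℕ}

/-- An `L(P)`-term is an `L`-term, since `P` adds no function symbols. -/
def termReduct : (LP L).Term α → L.Term α
  | .var a => .var a
  | .func (Sum.inl f) ts => .func f fun i => termReduct (ts i)
  | .func (Sum.inr f) _ => Empty.elim f

/-- The `L`-formula obtained from an atomic `L(P)`-formula by replacing `P(t)` with `φ(t, y)`. -/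
def relReduct (φ : L.Formula (Unit ⊕ Fin m)) : ∀ {l : ℕ}, (LP L).Relations l →
    (Fin l → L.Term ((α ⊕ Fin m) ⊕ Fin n)) → L.BoundedFormula (α ⊕ Fin m) n
  | _, Sum.inl R, ts => .rel R ts
  | 1, Sum.inr _, ts => BoundedFormula.relabel id (BoundedFormula.subst φ
      (Sum.elim (fun _ => ts 0) fun j => Term.var (Sum.inl (Sum.inr j))))
  | 0, Sum.inr R, _ => Empty.elim R
  | _ + 2, Sum.inr R, _ => Empty.elim R

/-- The `L`-formula obtained from an `L(P)`-formula by replacing `P(t)` with `φ(t, y)`. -/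
def reduct (φ : L.Formula (Unit ⊕ Fin m)) : ∀ {n : ℕ}, (LP L).BoundedFormula α n →
    L.BoundedFormula (α ⊕ Fin m) n
  | _, .falsum => .falsum
  | _, .equal t₁ t₂ => .equal ((termReduct t₁).relabel (Sum.map Sum.inl id))
      ((termReduct t₂).relabel (Sum.map Sum.inl id))
  | _, .rel R ts => relReduct φ R fun i => (termReduct (ts i)).relabel (Sum.map Sum.inl id)
  | _, .imp θ₁ θ₂ => (reduct φ θ₁).imp (reduct φ θ₂)
  | _, .all θ => (reduct φ θ).all

/-- The predicate symbol `P` of `L(P)`. -/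
def predSymb (L : FirstOrder.Language.{u, v}) : (LP L).Relations 1 :=
  Sum.inr PUnit.unit

variable {N : Type*} [L.Structure N]

theorem realize_termReduct (A : Set N) (t : (LP L).Term α) (v : α → N) :
    (termReduct t).realize v = @Term.realize (LP L) N (lpStruct L N A) _ v t := by
  let := lpStruct L N A
  induction t with
  | var a => rfl
  | func f ts ih =>
    rcases f with f | f
    · exact congrArg (Structure.funMap f) (funext ih)
    · exact Empty.elim f

theorem realize_relReduct (φ : L.Formula (Unit ⊕ Fin m)) {l : ℕ} (R : (LP L).Relations l)
    (ts : Fin l → L.Term ((α ⊕ Fin m) ⊕ Fin n)) (b : Fin m → N) (v : α → N) (xs : Fin n → N) :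
    (relReduct φ R ts).Realize (Sum.elim v b) xs ↔
      @Structure.RelMap (LP L) N (lpStruct L N {a | φ.Realize (Sum.elim (fun _ => a) b)}) l R
        fun i => (ts i).realize (Sum.elim (Sum.elim v b) xs) := by
  match l, R, ts with
  | _, Sum.inl R, ts => exact Iff.rfl
  | 0, Sum.inr R, _ => exact Empty.elim R
  | _ + 2, Sum.inr R, _ => exact Empty.elim R
  | 1, Sum.inr _, ts =>
    change _ ↔ BoundedFormula.Realize φ _ _
    rw [relReduct]
    refine BoundedFormula.realize_relabel.trans (BoundedFormula.realize_subst.trans ?_)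
    rw [iff_iff_eq]
    congr 1
    · funext j
      rcases j with j | j
      · simp only [Sum.elim_inl]
        congr 1
      · rfl
    · exact Subsingleton.elim _ _

theorem realize_reduct (φ : L.Formula (Unit ⊕ Fin m)) (θ : (LP L).BoundedFormula α n)
    (b : Fin m → N) (v : α → N) (xs : Fin n → N) :
    (reduct φ θ).Realize (Sum.elim v b) xs ↔
      @BoundedFormula.Realize (LP L) N (lpStruct L N {a | φ.Realize (Sum.elim (fun _ => a) b)})
        _ _ θ v xs := by
  have term_eq {k : ℕ} (t : (LP L).Term (α ⊕ Fin k)) (xs : Fin k → N) :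
      ((termReduct t).relabel (Sum.map Sum.inl id)).realize (Sum.elim (Sum.elim v b) xs) =
        @Term.realize (LP L) N (lpStruct L N {a | φ.Realize (Sum.elim (fun _ => a) b)}) _
          (Sum.elim v xs) t := by
    rw [Term.realize_relabel, ← realize_termReduct]
    congr 1
    funext j
    rcases j with j | j <;> rfl
  induction θ with
  | falsum => exact Iff.rfl
  | equal t₁ t₂ =>
    change Term.realize _ _ = Term.realize _ _ ↔ _
    rw [term_eq, term_eq]
    rfl
  | rel R ts =>
    rw [reduct, realize_relReduct]
    simp only [term_eq]
    rfl
  | imp θ₁ θ₂ ih₁ ih₂ => exact imp_congr (ih₁ xs) (ih₂ xs)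
  | all θ ih => exact forall_congr' fun a => ih (Fin.snoc xs a)

/-- The inclusion of `L` into `L(P)`. -/
def incl (L : FirstOrder.Language.{u, v}) : L →ᴸ LP L :=
  LHom.sumInl

theorem incl_isExpansionOn (A : Set N) :
    @LHom.IsExpansionOn L (LP L) (incl L) N _ (lpStruct L N A) :=
  @LHom.sumInl_isExpansionOn L pLang N _ (pStruct N A)

/-- The `L`-formula in `y` expressing that `P = φ(·, y)` satisfies `σ`. -/
def sentenceReduct (φ : L.Formula (Unit ⊕ Fin m)) (σ : (LP L).Sentence) : L.Formula (Fin m) :=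
  Formula.relabel (Sum.elim Empty.elim id) (reduct φ σ)

theorem realize_sentenceReduct (φ : L.Formula (Unit ⊕ Fin m)) (σ : (LP L).Sentence)
    (b : Fin m → N) :
    (sentenceReduct φ σ).Realize b ↔
      PSat L N {a | φ.Realize (Sum.elim (fun _ => a) b)} σ := by
  have comp_eq : b ∘ Sum.elim Empty.elim id = Sum.elim (default : Empty → N) b := by
    funext j
    rcases j with j | j
    · exact j.elim
    · rfl
  rw [sentenceReduct, Formula.realize_relabel, comp_eq]
  exact realize_reduct φ σ b default default

/-- The `L(P)`-sentence saying that `P` is `φ(·, y)` for some `y` satisfying `ψ`. -/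
noncomputable def existsParam (φ : L.Formula (Unit ⊕ Fin m)) (ψ : L.Formula (Fin m)) :
    (LP L).Sentence :=
  Formula.iExs (Fin m) (Formula.relabel Sum.inr
    ((incl L).onFormula ψ ⊓
      Formula.iAlls Unit (((predSymb L).formula₁ (Term.var (Sum.inr ()))).iff
        ((incl L).onFormula (φ.relabel Sum.swap)))))

theorem pSat_existsParam (φ : L.Formula (Unit ⊕ Fin m)) (ψ : L.Formula (Fin m)) (A : Set N) :
    PSat L N A (existsParam φ ψ) ↔
      ∃ b : Fin m → N, ψ.Realize b ∧ A = {a | φ.Realize (Sum.elim (fun _ => a) b)} := by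
  let : (LP L).Structure N := lpStruct L N A
  have : (incl L).IsExpansionOn N := incl_isExpansionOn A
  have realize_pred (v : Fin m ⊕ Unit → N) :
      ((predSymb L).formula₁ (Term.var (Sum.inr ()))).Realize v ↔ v (Sum.inr ()) ∈ A :=
    Formula.realize_rel₁
  change Formula.Realize (existsParam φ ψ) _ ↔ _
  rw [existsParam, Formula.realize_iExs]
  refine exists_congr fun b => ?_
  rw [Formula.realize_relabel, Sum.elim_comp_inr, Formula.realize_inf, LHom.realize_onFormula,
    Formula.realize_iAlls]
  refine and_congr_right fun _ => ?_
  have elim_swap (f : Unit → N) : Sum.elim b f ∘ Sum.swap = Sum.elim f b := by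
    funext j
    rcases j with j | j <;> rfl
  simp only [Formula.realize_iff, realize_pred, LHom.realize_onFormula, Formula.realize_relabel,
    elim_swap, Set.ext_iff, Sum.elim_inr]
  exact ⟨fun h a => h fun _ => a, fun h v => h (v ())⟩

end LP

/-!
STATEMENT 2: If `A = φ(M, b)` is a definable subset of `M`, then `A` is pseudofinite
in `M` if and only if for every `L`-formula `ψ(y)` with `M ⊨ ψ(b)` there are an
`L`-structure `M'` and `b'` in `M'` with `M' ⊨ ψ(b')` such that `φ(M', b')` is
finite.
-/

theorem pseudofinite_definable_iff
    {L : FirstOrder.Language.{u, v}} {M : Type w} [L.Structure M]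
    (m : ℕ) (φ : L.Formula (Unit ⊕ Fin m)) (b : Fin m → M)
    (A : Set M) (hA : A = {a | φ.Realize (Sum.elim (fun _ => a) b)}) :
    IsPseudofiniteIn L M A ↔
      ∀ ψ : L.Formula (Fin m), ψ.Realize b →
        ∃ (M' : Type (max u v w)) (_ : L.Structure M') (b' : Fin m → M'),
          ψ.Realize b' ∧ {a : M' | φ.Realize (Sum.elim (fun _ => a) b')}.Finite := by
  constructor
  · intro h ψ hψ
    obtain ⟨M', _, A', hfin, hsat⟩ :=
      h (LP.existsParam φ ψ) ((LP.pSat_existsParam φ ψ A).2 ⟨b, hψ, hA⟩)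
    obtain ⟨b', hb', rfl⟩ := (LP.pSat_existsParam φ ψ A').1 hsat
    exact ⟨M', _, b', hb', hfin⟩
  · rintro h σ hσ
    subst hA
    obtain ⟨M', _, b', hb', hfin⟩ :=
      h (LP.sentenceReduct φ σ) ((LP.realize_sentenceReduct φ σ b).2 hσ)
    exact ⟨M', _, _, hfin, (LP.realize_sentenceReduct φ σ b').1 hb'⟩
end

section
/- Let L be a first-order language, I an index set, 𝒰 an ultrafilter on I, and for each i ∈ I let M_i be an L-structure and A_i ⊆ M_i a nonempty finite subset. Let M* = ∏_𝒰 M_i be the ultraproduct. Then: (1) there is a well-defined Keisler measure μ on M* over M* such that for every L-formula φ(x,y) (x a single variable) and every b ∈ (M*)^{|y|} with representatives (b_i)_{i∈I}, μ({a ∈ M* : M* ⊨ φ(a,b)}) = lim_𝒰 |{a ∈ A_i : M_i ⊨ φ(a,b_i)}| / |A_i| (in particular this value depends only on the definable set and not on the chosen formula, parameter, or representatives); and (2) if the theory of M* is NIP, then μ is generically stable: there exists an elementary substructure M₀ ≼ M* of cardinality at most |L| + ℵ₀ such that μ is definable over M₀ and finitely satisfiable in M₀. -/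
/-!
STATEMENT 4: The pseudofinite counting measure on an ultraproduct.  Given
`L`-structures `M_i` with nonempty finite subsets `A_i` and an ultrafilter `𝒰`,
there is a Keisler measure `μ` on the ultraproduct `M* = ∏_𝒰 M_i` such that the
measure of every definable set `φ(M*, b)` is the `𝒰`-limit of the normalized
counting measures `|{a ∈ A_i : φ(a, b_i)}| / |A_i|`; and if `Th(M*)` is NIP then
`μ` is generically stable: definable over and finitely satisfiable in some
elementary substructure `M₀ ≼ M*` of cardinality at most `|L| + ℵ₀`.
-/

open FirstOrder

universe u v w x

/-- `s ⊆ M` is definable by an `L`-formula in one free variable with parameters from `P`. -/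
def DefOver (L : FirstOrder.Language.{u, v}) (M : Type*) [L.Structure M]
    (P : Set M) (s : Set M) : Prop :=
  ∃ (k : ℕ) (φ : L.Formula (Unit ⊕ Fin k)) (c : Fin k → M),
    (∀ j, c j ∈ P) ∧ s = {a | φ.Realize (Sum.elim (fun _ => a) c)}

/-- A subset of the `m`-tuple sort of `M`, definable with parameters from `P`. -/
def DefTupleOver (L : FirstOrder.Language.{u, v}) (M : Type*) [L.Structure M]
    (P : Set M) (m : ℕ) (s : Set (Fin m → M)) : Prop :=
  ∃ (k : ℕ) (φ : L.Formula (Fin m ⊕ Fin k)) (c : Fin k → M),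
    (∀ j, c j ∈ P) ∧ s = {b | φ.Realize (Sum.elim b c)}

/-- A Keisler measure on the definable set `V` over `M`. -/
def IsKeislerMeasureOn (L : FirstOrder.Language.{u, v}) (M : Type*) [L.Structure M]
    (V : Set M) (μ : Set M → ℝ) : Prop :=
  (∀ s, DefOver L M Set.univ s → s ⊆ V → 0 ≤ μ s) ∧ μ V = 1 ∧
    ∀ s t, DefOver L M Set.univ s → DefOver L M Set.univ t → s ⊆ V → t ⊆ V →
      Disjoint s t → μ (s ∪ t) = μ s + μ t

/-- The formula `φ(x, y)` is NIP in `M`. -/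
def FormulaIsNIPIn (L : FirstOrder.Language.{u, v}) (M : Type*) [L.Structure M]
    {α β : Type} (φ : L.Formula (α ⊕ β)) : Prop :=
  ∃ k : ℕ, ¬∃ (b : Fin k → β → M) (a : Set (Fin k) → α → M),
    ∀ (S : Set (Fin k)) (i : Fin k), φ.Realize (Sum.elim (a S) (b i)) ↔ i ∈ S

/-- The theory of `M` is NIP: every formula, with respect to every partition of its
free variables into two groups, is NIP in `M`. -/
def TheoryIsNIP (L : FirstOrder.Language.{u, v}) (M : Type*) [L.Structure M] : Prop :=
  ∀ (n m : ℕ) (φ : L.Formula (Fin n ⊕ Fin m)), FormulaIsNIPIn L M φ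

/-- The Keisler measure `μ` on `V` is definable over the parameter set `P`. -/
def MeasureDefOver (L : FirstOrder.Language.{u, v}) (M : Type*) [L.Structure M]
    (P : Set M) (V : Set M) (μ : Set M → ℝ) : Prop :=
  ∀ (m : ℕ) (φ : L.Formula (Unit ⊕ Fin m)) (ε : ℝ), 0 < ε →
    ∃ (r : ℕ) (B : Fin r → Set (Fin m → M)),
      (∀ t, DefTupleOver L M P m (B t)) ∧
      (⋃ t, B t) = Set.univ ∧ Pairwise (Function.onFun Disjoint B) ∧
      ∀ t, ∀ b ∈ B t, ∀ b' ∈ B t,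
        |μ (V ∩ {a | φ.Realize (Sum.elim (fun _ => a) b)}) -
            μ (V ∩ {a | φ.Realize (Sum.elim (fun _ => a) b')})| ≤ ε

/-- `μ` is finitely satisfiable in `P`. -/
def MeasureFinSatIn (L : FirstOrder.Language.{u, v}) (M : Type*) [L.Structure M]
    (P : Set M) (V : Set M) (μ : Set M → ℝ) : Prop :=
  ∀ s, DefOver L M Set.univ s → s ⊆ V → 0 < μ s → ∃ a ∈ s, a ∈ P

/-- No `k` points of `X` are shattered by the sets `{p | R p y}`, `y : Y`. -/
def NoShatter {X Y : Type*} (R : X → Y → Prop) (k : ℕ) : Prop :=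
  ¬∃ (b : Fin k → X) (a : Set (Fin k) → Y), ∀ (S : Set (Fin k)) (i : Fin k), R (b i) (a S) ↔ i ∈ S

/-- The proportion of the points of the finite family `p` that lie in `s`. -/
noncomputable def frequency {X J : Type*} [Fintype J] (p : J → X) (s : Set X) : ℝ :=
  (∑ j, s.indicator 1 (p j)) / Fintype.card J

/-- A family without shattered `k`-sets has polynomially many traces on finite sets. -/
theorem NoShatter.exists_traces {X Y : Type*} {R : X → Y → Prop} {k : ℕ} (h : NoShatter R k)
    {J : Type*} [Fintype J] (p : J → X) :
    ∃ 𝒯 : Finset (Finset J), 𝒯.card ≤ (k + 1) * (Fintype.card J + 1) ^ k ∧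
      ∀ y, ∃ T ∈ 𝒯, ∀ j, j ∈ T ↔ R (p j) y := by
  classical
  let 𝒯 : Finset (Finset J) := {T | ∃ y, ∀ j, j ∈ T ↔ R (p j) y}
  have hvc : 𝒯.vcDim ≤ k := by
    refine Finset.sup_le fun s hs => ?_
    rw [Finset.mem_shatterer] at hs
    by_contra! hk
    obtain ⟨t, hts, htk⟩ := Finset.exists_subset_card_eq hk.le
    have ht := hs.mono_right hts
    let e : Fin k ≃ t := (finCongr htk.symm).trans t.equivFin.symm
    have key : ∀ S : Set (Fin k), ∃ y, ∀ i, R (p (e i)) y ↔ i ∈ S := by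
      intro S
      obtain ⟨u, hu, htu⟩ := ht (Finset.filter_subset (fun j => ∃ i ∈ S, (e i : J) = j) t)
      obtain ⟨y, hy⟩ := (Finset.mem_filter.1 hu).2
      refine ⟨y, fun i => ?_⟩
      have := Finset.ext_iff.1 htu (e i)
      simp only [Finset.mem_inter, Finset.coe_mem, true_and, Finset.mem_filter] at this
      rw [← hy, this]
      constructor
      · rintro ⟨i', hi', he⟩
        rwa [← e.injective (Subtype.ext he)]
      · exact fun hi => ⟨i, hi, rfl⟩
    choose y hy using key
    exact h ⟨fun i => p (e i), y, hy⟩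
  refine ⟨𝒯, ?_, fun y => ⟨Finset.univ.filter fun j => R (p j) y, ?_, by simp⟩⟩
  · calc 𝒯.card ≤ ∑ i ∈ Finset.Iic 𝒯.vcDim, (Fintype.card J).choose i :=
          𝒯.card_le_card_shatterer.trans Finset.card_shatterer_le_sum_vcDim
      _ ≤ ∑ i ∈ Finset.Iic k, (Fintype.card J).choose i :=
          Finset.sum_le_sum_of_subset (Finset.Iic_subset_Iic.2 hvc)
      _ ≤ ∑ i ∈ Finset.Iic k, (Fintype.card J + 1) ^ k := by
          refine Finset.sum_le_sum fun i hi => (Nat.choose_le_pow _ _).trans ?_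
          exact (Nat.pow_le_pow_left (Nat.le_succ _) i).trans
            (Nat.pow_le_pow_right (Nat.succ_pos _) (Finset.mem_Iic.1 hi))
      _ = _ := by simp
  · simp only [𝒯, Finset.mem_filter, Finset.mem_univ, true_and]
    exact ⟨y, by simp⟩

/-- The exponential moment bound for a Rademacher sum with coefficients in `[-1, 1]`. -/
theorem sum_exp_rademacher_le {J : Type*} [Fintype J] [DecidableEq J] (d : J → ℝ)
    (hd : ∀ j, |d j| ≤ 1) (s : ℝ) :
    ∑ σ : J → Bool, Real.exp (s * ∑ j, (if σ j then d j else -d j)) ≤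
      2 ^ Fintype.card J * Real.exp (s ^ 2 / 2 * Fintype.card J) := by
  have h1 : ∀ σ : J → Bool, Real.exp (s * ∑ j, (if σ j then d j else -d j)) =
      ∏ j, Real.exp (s * (if σ j then d j else -d j)) := fun σ => by
    rw [Finset.mul_sum, Real.exp_sum]
  simp_rw [h1]
  rw [← Fintype.piFinset_univ, ← Finset.prod_univ_sum (fun _ : J => (Finset.univ : Finset Bool))
    (fun j b => Real.exp (s * (if b then d j else -d j)))]
  calc _ ≤ ∏ j : J, 2 * Real.exp (s ^ 2 / 2) := by
        refine Finset.prod_le_prod (fun j _ => Finset.sum_nonneg fun _ _ => (Real.exp_pos _).le)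
          fun j _ => ?_
        have h2 : ∑ b : Bool, Real.exp (s * (if b then d j else -d j)) =
            2 * Real.cosh (s * d j) := by
          rw [Real.cosh_eq]; simp; ring
        rw [h2]
        refine mul_le_mul_of_nonneg_left ((Real.cosh_le_exp_half_sq _).trans ?_) zero_le_two
        refine Real.exp_le_exp.2 (div_le_div_of_nonneg_right ?_ zero_le_two)
        rw [mul_pow]
        have := (sq_le_one_iff_abs_le_one (d j)).2 (hd j)
        nlinarith [sq_nonneg s]
    _ = _ := by
        rw [Finset.prod_const, mul_pow, ← Real.exp_nat_mul, Finset.card_univ, mul_comm (s ^ 2 / 2)]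

/-- A finite family of `±1`-sums with few members has simultaneously small discrepancy. -/
theorem exists_signs {J T : Type*} [Fintype J] [Nonempty J] (𝒯 : Finset T) (d : T → J → ℝ)
    (hd : ∀ t j, |d t j| ≤ 1) (δ : ℝ)
    (h𝒯 : 2 * (𝒯.card : ℝ) < Real.exp (2 * Fintype.card J * δ ^ 2)) (hδ : 0 < δ) :
    ∃ σ : J → Bool, ∀ t ∈ 𝒯, |∑ j, (if σ j then d t j else -d t j)| ≤ 2 * Fintype.card J * δ := by
  classical
  by_contra! hcon
  set n : ℝ := (Fintype.card J : ℝ) with hn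
  set Z : T → (J → Bool) → ℝ := fun t σ => ∑ j, (if σ j then d t j else -d t j)
  have hlow : ∀ σ : J → Bool, Real.exp (2 * δ * (2 * n * δ)) ≤
      ∑ t ∈ 𝒯, (Real.exp (2 * δ * Z t σ) + Real.exp (-(2 * δ) * Z t σ)) := by
    intro σ
    obtain ⟨t, ht, hlt⟩ := hcon σ
    refine le_trans ?_ (Finset.single_le_sum
      (f := fun t => Real.exp (2 * δ * Z t σ) + Real.exp (-(2 * δ) * Z t σ))
      (fun t _ => by positivity) ht)
    rcases lt_abs.1 hlt with h | h
    · refine le_trans (Real.exp_le_exp.2 ?_) (le_add_of_nonneg_right (Real.exp_pos _).le)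
      exact mul_le_mul_of_nonneg_left h.le (by positivity)
    · refine le_trans (Real.exp_le_exp.2 ?_) (le_add_of_nonneg_left (Real.exp_pos _).le)
      have := mul_le_mul_of_nonneg_left h.le (by positivity : 0 ≤ 2 * δ)
      change _ ≤ _ * -Z t σ at this
      linarith
  have hsum := Finset.sum_le_sum fun σ (_ : σ ∈ Finset.univ) => hlow σ
  rw [Finset.sum_comm] at hsum
  have hup : ∀ t ∈ 𝒯, ∑ σ, (Real.exp (2 * δ * Z t σ) + Real.exp (-(2 * δ) * Z t σ)) ≤
      2 * (2 ^ Fintype.card J * Real.exp (2 * n * δ ^ 2)) := by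
    intro t _
    rw [Finset.sum_add_distrib, two_mul (_ * _)]
    have e1 := sum_exp_rademacher_le (d t) (hd t) (2 * δ)
    have e2 := sum_exp_rademacher_le (d t) (hd t) (-(2 * δ))
    rw [show (2 * δ) ^ 2 / 2 * (Fintype.card J : ℝ) = 2 * n * δ ^ 2 by rw [hn]; ring] at e1
    rw [show (-(2 * δ)) ^ 2 / 2 * (Fintype.card J : ℝ) = 2 * n * δ ^ 2 by rw [hn]; ring] at e2
    exact add_le_add e1 e2
  have hfin := hsum.trans (Finset.sum_le_sum hup)
  rw [Finset.sum_const, Finset.sum_const, nsmul_eq_mul, nsmul_eq_mul, Finset.card_univ,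
    Fintype.card_fun, Fintype.card_bool,
    show 2 * δ * (2 * n * δ) = 2 * n * δ ^ 2 + 2 * n * δ ^ 2 by ring, Real.exp_add] at hfin
  push_cast at hfin
  have hpos : 0 < (2 : ℝ) ^ Fintype.card J * Real.exp (2 * n * δ ^ 2) := by positivity
  nlinarith

/-- One halving step: half of the points of a finite family represent the whole family well. -/
theorem NoShatter.exists_half {X Y : Type*} {R : X → Y → Prop} {k : ℕ} (h : NoShatter R k)
    {J : Type*} [Fintype J] [Nonempty J] (p : J × Bool → X) (δ : ℝ) (hδ : 0 < δ)
    (hJ : 2 * ((k + 1) * (2 * Fintype.card J + 1) ^ k : ℝ) <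
      Real.exp (2 * Fintype.card J * δ ^ 2)) :
    ∃ q : J → X, ∀ y, |frequency q {a | R a y} - frequency p {a | R a y}| ≤ δ := by
  classical
  obtain ⟨𝒯, hcard, htr⟩ := h.exists_traces p
  let f : Finset (J × Bool) → J × Bool → ℝ := fun T j => if j ∈ T then 1 else 0
  obtain ⟨σ, hσ⟩ := exists_signs (J := J) 𝒯 (fun T j => f T (j, true) - f T (j, false))
    (fun T j => by dsimp only [f]; split_ifs <;> norm_num) δ (by
      refine lt_of_le_of_lt ?_ hJ
      gcongr
      have : (𝒯.card : ℝ) ≤ (((k + 1) * (Fintype.card (J × Bool) + 1) ^ k : ℕ) : ℝ) :=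
        Nat.cast_le.2 hcard
      rw [Fintype.card_prod, Fintype.card_bool, mul_comm _ 2] at this
      exact_mod_cast this) hδ
  refine ⟨fun j => p (j, σ j), fun y => ?_⟩
  obtain ⟨T, hT, hTy⟩ := htr y
  have hf : ∀ j, ({a | R a y} : Set X).indicator (1 : X → ℝ) (p j) = f T j := fun j => by
    simp only [f, hTy, Set.indicator_apply, Set.mem_ofPred_eq, Pi.one_apply]
  have hn : (0 : ℝ) < Fintype.card J := Nat.cast_pos.2 Fintype.card_pos
  have key : frequency (fun j => p (j, σ j)) {a | R a y} - frequency p {a | R a y} =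
      (∑ j, (if σ j then f T (j, true) - f T (j, false) else -(f T (j, true) - f T (j, false)))) /
        (2 * Fintype.card J) := by
    simp only [frequency, hf, Fintype.card_prod, Fintype.card_bool, Fintype.sum_prod_type,
      Fintype.sum_bool]
    have : ∀ j, (if σ j then f T (j, true) - f T (j, false) else
        -(f T (j, true) - f T (j, false))) =
        2 * f T (j, σ j) - (f T (j, true) + f T (j, false)) := fun j => by
      cases σ j <;> simp <;> ring
    simp only [this, Finset.sum_sub_distrib, ← Finset.mul_sum]
    push_cast
    field_simp
  rw [key, abs_div, abs_of_pos (by positivity : (0 : ℝ) < 2 * Fintype.card J),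
    div_le_iff₀ (by positivity)]
  linarith [hσ T hT]

theorem frequency_comp_equiv {X J K : Type*} [Fintype J] [Fintype K] (e : J ≃ K) (p : K → X)
    (s : Set X) : frequency (p ∘ e) s = frequency p s := by
  simp only [frequency, Function.comp_apply, Fintype.card_congr e]
  rw [e.sum_comp fun j => s.indicator (1 : X → ℝ) (p j)]

theorem eventually_halving_bound (k : ℕ) : ∀ᶠ t : ℕ in Filter.atTop,
    2 * ((k + 1) * (2 * 2 ^ t + 1) ^ k : ℝ) < Real.exp (2 * 2 ^ t * ((9 / 10 : ℝ) ^ t) ^ 2) := by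
  have hr : (1 : ℝ) < 81 / 50 := by norm_num
  set c : ℝ := 2 * ((k + 1) * 4 ^ k) with hc
  have h1 := (tendsto_pow_atTop_atTop_of_one_lt hr).eventually_ge_atTop c
  have h2 : ∀ᶠ t : ℕ in Filter.atTop, (2 : ℝ) ^ k * t < (81 / 50) ^ t := by
    have := (tendsto_pow_const_div_const_pow_of_one_lt 1 hr).const_mul ((2 : ℝ) ^ k)
    rw [mul_zero] at this
    filter_upwards [this.eventually_lt_const one_pos] with t ht
    rwa [pow_one, ← mul_div_assoc, div_lt_one (by positivity)] at ht
  filter_upwards [h1, h2] with t ht1 ht2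
  have hexp : (2 : ℝ) * 2 ^ t * ((9 / 10 : ℝ) ^ t) ^ 2 = (81 / 50) ^ t + (81 / 50) ^ t := by
    rw [← pow_mul, mul_comm t 2, pow_mul, mul_assoc, ← mul_pow, ← two_mul]
    norm_num
  have ht : (1 : ℝ) ≤ 2 ^ t := one_le_pow₀ one_le_two
  calc (2 : ℝ) * ((k + 1) * (2 * 2 ^ t + 1) ^ k) ≤ 2 * ((k + 1) * (4 * 2 ^ t) ^ k) := by
        gcongr; linarith
    _ = c * (2 ^ k) ^ t := by rw [hc, mul_pow, ← pow_mul, ← pow_mul, mul_comm t k]; ring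
    _ ≤ Real.exp c * Real.exp (2 ^ k) ^ t := by
        gcongr <;> exact (lt_add_one _).le.trans (Real.add_one_le_exp _)
    _ = Real.exp (c + 2 ^ k * t) := by rw [← Real.exp_nat_mul, ← Real.exp_add, mul_comm (t : ℝ)]
    _ < _ := by
        rw [hexp]
        exact Real.exp_lt_exp.2 (add_lt_add_of_le_of_lt ht1 ht2)

/-- Iterated halving: a family of `2 ^ t` points is represented by a subfamily of `2 ^ s`. -/
theorem NoShatter.exists_thinning {X Y : Type*} {R : X → Y → Prop} {k : ℕ} (h : NoShatter R k)
    {s : ℕ} (hs : ∀ t ≥ s,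
      2 * ((k + 1) * (2 * 2 ^ t + 1) ^ k : ℝ) < Real.exp (2 * 2 ^ t * ((9 / 10 : ℝ) ^ t) ^ 2))
    {t : ℕ} (hst : s ≤ t) (p : Fin (2 ^ t) → X) :
    ∃ q : Fin (2 ^ s) → X, ∀ y, |frequency q {a | R a y} - frequency p {a | R a y}| ≤
      10 * (9 / 10) ^ s - 10 * (9 / 10) ^ t := by
  induction t, hst using Nat.le_induction with
  | base => exact ⟨p, fun y => by simp⟩
  | succ t hst ih =>
    have e : Fin (2 ^ t) × Bool ≃ Fin (2 ^ (t + 1)) :=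
      Fintype.equivOfCardEq (by simp [pow_succ])
    obtain ⟨q, hq⟩ := h.exists_half (p ∘ e) ((9 / 10) ^ t) (by positivity) (by
      simpa using hs t hst)
    obtain ⟨r, hr⟩ := ih q
    refine ⟨r, fun y => ?_⟩
    have h1 := hq y
    have h2 := hr y
    rw [frequency_comp_equiv] at h1
    have h3 := abs_sub_le (frequency r {a | R a y}) (frequency q {a | R a y})
      (frequency p {a | R a y})
    have h4 : (9 / 10 : ℝ) ^ (t + 1) = (9 / 10) ^ t * (9 / 10) := pow_succ _ _
    linarith

/-- A nonempty finite set is represented with any accuracy by a large family of `N` points. -/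
theorem exists_frequency_approx {X : Type*} {A : Set X} (hA : A.Finite) (hne : A.Nonempty)
    {N : ℕ} (hN : 0 < N) : ∃ p : Fin N → X, ∀ s : Set X,
      |frequency p s - (Nat.card {a // a ∈ A ∧ a ∈ s} : ℝ) / Nat.card A| ≤ Nat.card A / N := by
  classical
  have := hA.fintype
  obtain ⟨a₀, ha₀⟩ := hne
  have hA0 : 0 < Fintype.card A := Fintype.card_pos_iff.2 ⟨⟨a₀, ha₀⟩⟩
  set n := Fintype.card A with hn
  let J := (A × Fin (N / n)) ⊕ Fin (N % n)
  have e : Fin N ≃ J := Fintype.equivOfCardEq (by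
    simp only [J, Fintype.card_sum, Fintype.card_prod, Fintype.card_fin, ← hn, Nat.div_add_mod])
  let p : J → X := Sum.elim (fun j => (j.1 : X)) fun _ => a₀
  refine ⟨p ∘ e, fun s => ?_⟩
  have hcard : (Nat.card {a // a ∈ A ∧ a ∈ s} : ℝ) = ∑ a : A, s.indicator (1 : X → ℝ) a := by
    rw [← Nat.card_congr (Equiv.subtypeSubtypeEquivSubtypeInter (· ∈ A) (· ∈ s)),
      Nat.card_eq_fintype_card, Fintype.card_subtype]
    simp [Set.indicator_apply]
  have hJ : Fintype.card J = N := by rw [← Fintype.card_congr e, Fintype.card_fin]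
  have hND : (N : ℝ) = n * (N / n : ℕ) + (N % n : ℕ) := by
    exact_mod_cast (Nat.div_add_mod N n).symm
  rw [frequency_comp_equiv, Nat.card_eq_fintype_card (α := A), hcard, frequency, hJ, ← hn]
  simp only [J, p, Fintype.sum_sum_type, Sum.elim_inl, Sum.elim_inr, Fintype.sum_prod_type,
    Finset.sum_const, Finset.card_univ, Fintype.card_fin, nsmul_eq_mul, ← Finset.mul_sum]
  set S := ∑ a : A, s.indicator (1 : X → ℝ) a
  set u := s.indicator (1 : X → ℝ) a₀
  have hind : ∀ a : X, 0 ≤ s.indicator (1 : X → ℝ) a ∧ s.indicator (1 : X → ℝ) a ≤ 1 := fun a => by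
    by_cases h : a ∈ s <;> simp [h]
  have hS0 : 0 ≤ S := Finset.sum_nonneg fun a _ => (hind a).1
  have hS1 : S ≤ n := by
    simpa [hn] using Finset.sum_le_sum fun (a : A) (_ : a ∈ Finset.univ) => (hind a).2
  have hn' : (0 : ℝ) < n := Nat.cast_pos.2 hA0
  have hN' : (0 : ℝ) < N := Nat.cast_pos.2 hN
  have hmod : ((N % n : ℕ) : ℝ) ≤ n := Nat.cast_le.2 (Nat.mod_lt _ hA0).le
  have key : (((N / n : ℕ) : ℝ) * S + (N % n : ℕ) * u) / N - S / n =
      (N % n : ℕ) * (u - S / n) / N := by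
    field_simp
    rw [hND]
    ring
  rw [key, abs_div, abs_of_pos hN', abs_mul, Nat.abs_cast]
  gcongr
  refine (mul_le_of_le_one_right (Nat.cast_nonneg _) ?_).trans hmod
  rw [abs_sub_le_iff]
  have := div_nonneg hS0 hn'.le
  have := (div_le_one hn').2 hS1
  constructor <;> linarith [(hind a₀).1, (hind a₀).2]

/-- **Uniform law of large numbers** for finite uniform measures: the size of the approximating
family depends only on the accuracy and the shattering bound. -/
theorem exists_uniform_approximation (k : ℕ) {ε : ℝ} (hε : 0 < ε) :
    ∃ n : ℕ, ∀ {X Y : Type*} {R : X → Y → Prop}, NoShatter R k → ∀ {A : Set X}, A.Finite →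
      A.Nonempty → ∃ q : Fin n → X, ∀ y,
        |frequency q {a | R a y} - (Nat.card {a // a ∈ A ∧ R a y} : ℝ) / Nat.card A| ≤ ε := by
  have hlim : Filter.Tendsto (fun s : ℕ => 10 * (9 / 10 : ℝ) ^ s) Filter.atTop (nhds 0) := by
    simpa using (tendsto_pow_atTop_nhds_zero_of_lt_one (by norm_num : (0 : ℝ) ≤ 9 / 10)
      (by norm_num)).const_mul 10
  obtain ⟨s, hs, hsε⟩ := ((Filter.eventually_forall_ge_atTop.2 (eventually_halving_bound k)).and
    (hlim.eventually_lt_const (half_pos hε))).exists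
  refine ⟨2 ^ s, fun {X Y R} hR A hA hne => ?_⟩
  obtain ⟨t, ht, hst⟩ := (((tendsto_pow_atTop_atTop_of_one_lt
    (one_lt_two (α := ℝ))).eventually_ge_atTop (Nat.card A / (ε / 2))).and
      (Filter.eventually_ge_atTop s)).exists
  obtain ⟨p, hp⟩ := exists_frequency_approx hA hne (N := 2 ^ t) (by positivity)
  obtain ⟨q, hq⟩ := hR.exists_thinning hs hst p
  refine ⟨q, fun y => ?_⟩
  have h1 := hp {a | R a y}
  have h2 := hq y
  have h3 : (Nat.card A : ℝ) / (2 ^ t : ℕ) ≤ ε / 2 := by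
    push_cast
    rw [div_le_iff₀ (by positivity)]
    rwa [div_le_iff₀' (by positivity)] at ht
  have h4 : (0 : ℝ) < (9 / 10) ^ t := by positivity
  have h5 := abs_sub_le (frequency q {a | R a y}) (frequency p {a | R a y})
    ((Nat.card {a // a ∈ A ∧ R a y} : ℝ) / Nat.card A)
  exact h5.trans (by linarith! [h1])

section Ultraproduct

open Filter

variable {ι : Type w} (𝒰 : Ultrafilter ι) {Mi : ι → Type x}

/-- The element of the ultraproduct represented by a family. -/
def toProduct (a : ∀ i, Mi i) : (𝒰 : Filter ι).Product Mi :=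
  (a : (𝒰 : Filter ι).Product Mi)

/-- The set `s` of an ultraproduct is the internal set given by the family `T`. -/
def IsInternal (s : Set ((𝒰 : Filter ι).Product Mi)) (T : ∀ i, Set (Mi i)) : Prop :=
  ∀ a : ∀ i, Mi i, (toProduct 𝒰 a ∈ s ↔ ∀ᶠ i in 𝒰, a i ∈ T i)

variable {𝒰}

theorem IsInternal.eventuallyEq [∀ i, Nonempty (Mi i)] {s : Set ((𝒰 : Filter ι).Product Mi)}
    {T T' : ∀ i, Set (Mi i)} (h : IsInternal 𝒰 s T) (h' : IsInternal 𝒰 s T') :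
    ∀ᶠ i in 𝒰, T i = T' i := by
  by_contra hne
  rw [← Ultrafilter.eventually_not] at hne
  have : ∀ᶠ i in 𝒰, ∃ a : Mi i, ¬(a ∈ T i ↔ a ∈ T' i) :=
    hne.mono fun i hi => not_forall.1 fun h => hi (Set.ext h)
  obtain ⟨a, ha⟩ := Filter.skolem.1 this
  have hiff := (h a).symm.trans (h' a)
  by_cases hT : ∀ᶠ i in 𝒰, a i ∈ T i
  · obtain ⟨i, hi, h1, h2⟩ := (ha.and (hT.and (hiff.1 hT))).exists
    exact hi ⟨fun _ => h2, fun _ => h1⟩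
  · have hT' := mt hiff.2 hT
    rw [← Ultrafilter.eventually_not] at hT hT'
    obtain ⟨i, hi, h1, h2⟩ := (ha.and (hT.and hT')).exists
    exact hi ⟨fun h => (h1 h).elim, fun h => (h2 h).elim⟩

/-- The normalized counting measure on `A`. -/
noncomputable def countingRatio {X : Type*} (A s : Set X) : ℝ :=
  (Nat.card {a // a ∈ A ∧ a ∈ s} : ℝ) / Nat.card A

theorem countingRatio_nonneg {X : Type*} (A s : Set X) : 0 ≤ countingRatio A s := by
  unfold countingRatio; positivity

theorem countingRatio_le_one {X : Type*} {A : Set X} (hA : A.Finite) (s : Set X) :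
    countingRatio A s ≤ 1 :=
  div_le_one_of_le₀ (Nat.cast_le.2 (Nat.card_mono hA fun _ h => h.1)) (Nat.cast_nonneg _)

theorem countingRatio_univ {X : Type*} {A : Set X} (hA : A.Finite) (hne : A.Nonempty) :
    countingRatio A Set.univ = 1 := by
  have := hA.to_subtype
  have := hne.to_subtype
  have h : Nat.card {a // a ∈ A ∧ a ∈ Set.univ} = Nat.card A :=
    Nat.card_congr (Equiv.subtypeEquivRight fun a => by simp)
  rw [countingRatio, h, div_self (Nat.cast_ne_zero.2 Nat.card_pos.ne')]

theorem countingRatio_union {X : Type*} {A : Set X} (hA : A.Finite) {s t : Set X}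
    (hst : Disjoint s t) : countingRatio A (s ∪ t) = countingRatio A s + countingRatio A t := by
  rw [countingRatio, countingRatio, countingRatio, ← add_div, ← Nat.cast_add]
  congr 2
  change (A ∩ (s ∪ t)).ncard = (A ∩ s).ncard + (A ∩ t).ncard
  rw [Set.inter_union_distrib_left]
  exact Set.ncard_union_eq (hst.mono Set.inter_subset_right Set.inter_subset_right)
    (hA.subset Set.inter_subset_left) (hA.subset Set.inter_subset_left)

open Classical in
/-- The ultralimit of normalized counting measures, on internal sets. -/
noncomputable def loebMeasure (A : ∀ i, Set (Mi i)) (s : Set ((𝒰 : Filter ι).Product Mi)) : ℝ :=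
  if h : ∃ T, IsInternal 𝒰 s T then limUnder 𝒰 fun i => countingRatio (A i) (h.choose i) else 0

theorem IsInternal.tendsto_loebMeasure [∀ i, Nonempty (Mi i)] {A : ∀ i, Set (Mi i)}
    (hfin : ∀ i, (A i).Finite) {s : Set ((𝒰 : Filter ι).Product Mi)} {T : ∀ i, Set (Mi i)}
    (h : IsInternal 𝒰 s T) :
    Tendsto (fun i => countingRatio (A i) (T i)) 𝒰 (nhds (loebMeasure A s)) := by
  have hex : ∃ T, IsInternal 𝒰 s T := ⟨T, h⟩
  obtain ⟨r, -, hr⟩ := (isCompact_Icc (a := (0 : ℝ)) (b := 1)).ultrafilter_le_nhds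
    (𝒰.map fun i => countingRatio (A i) (hex.choose i)) (by
      rw [le_principal_iff]
      exact Eventually.of_forall (f := (𝒰 : Filter ι)) fun i =>
        ⟨countingRatio_nonneg _ _, countingRatio_le_one (hfin i) _⟩)
  rw [loebMeasure, dif_pos hex]
  refine (tendsto_nhds_limUnder ⟨r, hr⟩).congr' ?_
  filter_upwards [hex.choose_spec.eventuallyEq h] with i hi
  rw [hi]

theorem IsInternal.univ : IsInternal 𝒰 (Set.univ : Set ((𝒰 : Filter ι).Product Mi))
    fun _ => Set.univ := fun a => by simp

theorem IsInternal.union {s t : Set ((𝒰 : Filter ι).Product Mi)} {S T : ∀ i, Set (Mi i)}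
    (hs : IsInternal 𝒰 s S) (ht : IsInternal 𝒰 t T) :
    IsInternal 𝒰 (s ∪ t) fun i => S i ∪ T i := fun a => by
  simp only [Set.mem_union, hs a, ht a, Ultrafilter.eventually_or]

theorem IsInternal.eventually_disjoint [∀ i, Nonempty (Mi i)]
    {s t : Set ((𝒰 : Filter ι).Product Mi)} {S T : ∀ i, Set (Mi i)}
    (hs : IsInternal 𝒰 s S) (ht : IsInternal 𝒰 t T) (hst : Disjoint s t) :
    ∀ᶠ i in 𝒰, Disjoint (S i) (T i) := by
  have h1 : IsInternal 𝒰 (s ∩ t) fun i => S i ∩ T i := fun a => by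
    simp only [Set.mem_inter_iff, hs a, ht a, eventually_and]
  have h2 : IsInternal 𝒰 (s ∩ t) fun _ => ∅ := fun a => by
    simp [hst.inter_eq, 𝒰.neBot.ne]
  filter_upwards [h1.eventuallyEq h2] with i hi
  exact Set.disjoint_iff_inter_eq_empty.2 hi

theorem exists_cast_eq {α : Type*} (b : α → (𝒰 : Filter ι).Product Mi) :
    ∃ c : α → ∀ i, Mi i, b = fun j => toProduct 𝒰 (c j) :=
  ⟨fun j => (b j).out, funext fun j => (Quotient.out_eq (b j)).symm⟩

variable {L : FirstOrder.Language.{u, v}} [∀ i, L.Structure (Mi i)] [∀ i, Nonempty (Mi i)]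

/-- Łoś's theorem for a formula in two groups of variables. -/
theorem realize_sumElim_cast {α β : Type*} (φ : L.Formula (α ⊕ β)) (a : α → ∀ i, Mi i)
    (b : β → ∀ i, Mi i) :
    φ.Realize (Sum.elim (fun j => toProduct 𝒰 (a j)) fun j => toProduct 𝒰 (b j)) ↔
      ∀ᶠ i in 𝒰, φ.Realize (Sum.elim (fun j => a j i) fun j => b j i) := by
  have h := FirstOrder.Language.Ultraproduct.realize_formula_cast (u := 𝒰) φ (Sum.elim a b)
  have e1 : (fun j => toProduct 𝒰 (Sum.elim a b j)) =
      Sum.elim (fun j => toProduct 𝒰 (a j)) fun j => toProduct 𝒰 (b j) := by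
    ext j; cases j <;> rfl
  have e2 : ∀ i, (fun j => Sum.elim a b j i) = Sum.elim (fun j => a j i) fun j => b j i :=
    fun i => by ext j; cases j <;> rfl
  simp only [e2] at h
  rw [← e1]
  exact h

theorem isInternal_formula {m : ℕ} (φ : L.Formula (Unit ⊕ Fin m)) (b : Fin m → ∀ i, Mi i) :
    IsInternal 𝒰 {a | φ.Realize (Sum.elim (fun _ => a)
        fun j => toProduct 𝒰 (b j))}
      fun i => {a | φ.Realize (Sum.elim (fun _ => a) fun j => b j i)} :=
  fun a => realize_sumElim_cast φ (fun _ => a) b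

theorem DefOver.exists_isInternal {P s : Set ((𝒰 : Filter ι).Product Mi)}
    (h : DefOver L ((𝒰 : Filter ι).Product Mi) P s) : ∃ T, IsInternal 𝒰 s T := by
  obtain ⟨m, φ, b, -, rfl⟩ := h
  obtain ⟨c, rfl⟩ := exists_cast_eq b
  exact ⟨_, isInternal_formula φ c⟩

theorem isKeislerMeasureOn_loebMeasure {A : ∀ i, Set (Mi i)} (hfin : ∀ i, (A i).Finite)
    (hne : ∀ i, (A i).Nonempty) :
    IsKeislerMeasureOn L ((𝒰 : Filter ι).Product Mi) Set.univ (loebMeasure A) := by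
  refine ⟨fun s hs _ => ?_, ?_, fun s t hs ht _ _ hst => ?_⟩
  · obtain ⟨T, hT⟩ := hs.exists_isInternal
    exact ge_of_tendsto' (hT.tendsto_loebMeasure hfin) fun i => countingRatio_nonneg _ _
  · refine tendsto_nhds_unique (IsInternal.univ.tendsto_loebMeasure hfin)
      (tendsto_const_nhds.congr fun i => ?_)
    exact (countingRatio_univ (hfin i) (hne i)).symm
  · obtain ⟨S, hS⟩ := hs.exists_isInternal
    obtain ⟨T, hT⟩ := ht.exists_isInternal
    refine tendsto_nhds_unique ((hS.union hT).tendsto_loebMeasure hfin)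
      (((hS.tendsto_loebMeasure hfin).add (hT.tendsto_loebMeasure hfin)).congr' ?_)
    filter_upwards [hS.eventually_disjoint hT hst] with i hi
    exact (countingRatio_union (hfin i) hi).symm

theorem TheoryIsNIP.exists_noShatter {M : Type*} [L.Structure M] (h : TheoryIsNIP L M) {m : ℕ}
    (φ : L.Formula (Unit ⊕ Fin m)) :
    ∃ k, NoShatter (fun (a : M) (b : Fin m → M) => φ.Realize (Sum.elim (fun _ => a) b)) k := by
  obtain ⟨k, hk⟩ := h m 1 (φ.relabel (Sum.elim (fun _ => Sum.inr 0) Sum.inl))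
  refine ⟨k, fun ⟨b, a, hab⟩ => hk ⟨fun i _ => b i, a, fun S i => ?_⟩⟩
  rw [FirstOrder.Language.Formula.realize_relabel, ← hab S i]
  convert! Iff.rfl using 2
  ext j
  cases j <;> rfl

theorem NoShatter.eventually {m k : ℕ} {φ : L.Formula (Unit ⊕ Fin m)}
    (h : NoShatter (fun (a : (𝒰 : Filter ι).Product Mi) (b : Fin m → (𝒰 : Filter ι).Product Mi) =>
      φ.Realize (Sum.elim (fun _ => a) b)) k) :
    ∀ᶠ i in 𝒰, NoShatter (fun (a : Mi i) (b : Fin m → Mi i) =>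
      φ.Realize (Sum.elim (fun _ => a) b)) k := by
  by_contra hcon
  rw [← Ultrafilter.eventually_not] at hcon
  obtain ⟨b, hb⟩ := Filter.skolem.1 (hcon.mono fun i hi => not_not.1 hi)
  obtain ⟨a, ha⟩ := Filter.skolem.1 hb
  refine h ⟨fun j => toProduct 𝒰 (fun i => b i j),
    fun S l => toProduct 𝒰 (fun i => a i S l), fun S j => ?_⟩
  refine (realize_sumElim_cast (𝒰 := 𝒰) φ (fun _ i => b i j) fun l i => a i S l).trans ?_
  rw [← eventually_const (f := (𝒰 : Filter ι)) (p := j ∈ S)]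
  exact eventually_congr (ha.mono fun i hi => hi S j)

/-- In an NIP ultraproduct, the limit of counting measures is uniformly approximated on every
definable family by the frequency of a finite tuple. -/
theorem exists_frequency_approx_loebMeasure {A : ∀ i, Set (Mi i)} (hfin : ∀ i, (A i).Finite)
    (hne : ∀ i, (A i).Nonempty) (hNIP : TheoryIsNIP L ((𝒰 : Filter ι).Product Mi)) {m : ℕ}
    (φ : L.Formula (Unit ⊕ Fin m)) {ε : ℝ} (hε : 0 < ε) :
    ∃ (n : ℕ) (q : Fin n → (𝒰 : Filter ι).Product Mi), ∀ b : Fin m → (𝒰 : Filter ι).Product Mi,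
      |frequency q {a | φ.Realize (Sum.elim (fun _ => a) b)} -
        loebMeasure A {a | φ.Realize (Sum.elim (fun _ => a) b)}| ≤ ε := by
  obtain ⟨k, hk⟩ := hNIP.exists_noShatter φ
  obtain ⟨n, hn⟩ := exists_uniform_approximation.{x, x} k hε
  obtain ⟨q, hq⟩ := Filter.skolem.1 (hk.eventually.mono fun i hi => hn hi (hfin i) (hne i))
  refine ⟨n, fun j => toProduct 𝒰 (fun i => q i j), fun b => ?_⟩
  obtain ⟨c, rfl⟩ := exists_cast_eq b
  have hint := isInternal_formula (𝒰 := 𝒰) φ c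
  refine le_of_tendsto ((tendsto_const_nhds.sub (hint.tendsto_loebMeasure hfin)).abs) ?_
  have hpat : ∀ᶠ i in 𝒰, ∀ j : Fin n,
      (toProduct 𝒰 (fun i => q i j) ∈
        {a | φ.Realize (Sum.elim (fun _ => a) fun j => toProduct 𝒰 (c j))} ↔
        q i j ∈ {a | φ.Realize (Sum.elim (fun _ => a) fun j => c j i)}) := by
    refine eventually_all.2 fun j => ?_
    have h := hint fun i => q i j
    by_cases hj : ∀ᶠ i in 𝒰, q i j ∈ {a | φ.Realize (Sum.elim (fun _ => a) fun j => c j i)}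
    · exact hj.mono fun i hi => iff_of_true (h.2 hj) hi
    · have hj' := Ultrafilter.eventually_not.2 hj
      exact hj'.mono fun i hi => iff_of_false (mt h.1 hj) hi
  filter_upwards [hpat, hq] with i hi hqi
  convert! hqi fun j => c j i using 3
  classical
  simp only [frequency, Set.indicator_apply, Set.mem_ofPred_eq, Pi.one_apply]
  simp only [hi]

end Ultraproduct

theorem frequency_pos_exists_mem {X J : Type*} [Fintype J] {p : J → X} {s : Set X}
    (h : 0 < frequency p s) : ∃ j, p j ∈ s := by
  by_contra! hcon
  simp [frequency, Set.indicator_of_notMem (hcon _)] at h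

/-- A measure uniformly approximated by frequencies of tuples from `P` is definable over `P`. -/
theorem measureDefOver_of_frequency {L : FirstOrder.Language.{u, v}} {M : Type*} [L.Structure M]
    {P : Set M} {μ : Set M → ℝ}
    (h : ∀ (m : ℕ) (φ : L.Formula (Unit ⊕ Fin m)) (ε : ℝ), 0 < ε →
      ∃ (n : ℕ) (q : Fin n → M), (∀ j, q j ∈ P) ∧ ∀ b : Fin m → M,
        |frequency q {a | φ.Realize (Sum.elim (fun _ => a) b)} -
          μ {a | φ.Realize (Sum.elim (fun _ => a) b)}| ≤ ε) :
    MeasureDefOver L M P Set.univ μ := by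
  classical
  intro m φ ε hε
  obtain ⟨n, q, hqP, hq⟩ := h m φ (ε / 2) (half_pos hε)
  let e := Fintype.equivFin (Finset (Fin n))
  let ψ : Fin n → L.Formula (Fin m ⊕ Fin n) := fun j =>
    φ.relabel (Sum.elim (fun _ => Sum.inr j) Sum.inl)
  have hψ : ∀ j b, (ψ j).Realize (Sum.elim b q) ↔ φ.Realize (Sum.elim (fun _ => q j) b) := by
    intro j b
    rw [FirstOrder.Language.Formula.realize_relabel]
    convert! Iff.rfl using 2
    ext l
    cases l <;> rfl
  let B : Finset (Fin n) → Set (Fin m → M) := fun T =>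
    {b | ∀ j, j ∈ T ↔ φ.Realize (Sum.elim (fun _ => q j) b)}
  refine ⟨_, fun t => B (e.symm t), fun t => ?_, ?_, fun t t' htt' => ?_, fun t b hb b' hb' => ?_⟩
  · refine ⟨n, FirstOrder.Language.Formula.iInf fun j : Fin n =>
      if j ∈ e.symm t then ψ j else (ψ j).not, q, hqP, ?_⟩
    ext b
    simp only [B, Set.mem_ofPred_eq, FirstOrder.Language.Formula.realize_iInf]
    refine forall_congr' fun j => ?_
    split_ifs with hj <;> simp [hj, hψ]
  · refine Set.eq_univ_of_forall fun b => Set.mem_iUnion.2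
      ⟨e (Finset.univ.filter fun j => φ.Realize (Sum.elim (fun _ => q j) b)), ?_⟩
    simp [B]
  · refine Set.disjoint_left.2 fun b hb hb' => htt' (e.symm.injective (Finset.ext fun j => ?_))
    exact (hb j).trans (hb' j).symm
  · have hfreq : frequency q {a | φ.Realize (Sum.elim (fun _ => a) b)} =
        frequency q {a | φ.Realize (Sum.elim (fun _ => a) b')} := by
      simp only [frequency, Set.indicator_apply, Set.mem_ofPred_eq, ← hb _, ← hb' _]
    have h1 := abs_le.1 (hq b)
    have h2 := abs_le.1 (hq b')
    rw [hfreq] at h1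
    simp only [Set.univ_inter]
    rw [abs_le]
    constructor <;> linarith [h1.1, h1.2, h2.1, h2.2]

/-- A measure uniformly approximated by frequencies of tuples from `P` is finitely satisfiable
in `P`. -/
theorem measureFinSatIn_of_frequency {L : FirstOrder.Language.{u, v}} {M : Type*} [L.Structure M]
    {P : Set M} {μ : Set M → ℝ}
    (h : ∀ (m : ℕ) (φ : L.Formula (Unit ⊕ Fin m)) (ε : ℝ), 0 < ε →
      ∃ (n : ℕ) (q : Fin n → M), (∀ j, q j ∈ P) ∧ ∀ b : Fin m → M,
        |frequency q {a | φ.Realize (Sum.elim (fun _ => a) b)} -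
          μ {a | φ.Realize (Sum.elim (fun _ => a) b)}| ≤ ε) :
    MeasureFinSatIn L M P Set.univ μ := by
  rintro s ⟨m, φ, b, -, rfl⟩ - hpos
  obtain ⟨n, q, hqP, hq⟩ := h m φ _ (half_pos hpos)
  obtain ⟨j, hj⟩ := frequency_pos_exists_mem (p := q)
    (s := {a | φ.Realize (Sum.elim (fun _ => a) b)}) (by linarith [(abs_le.1 (hq b)).1])
  exact ⟨q j, hj, hqP j⟩

/-- A form of the downward Löwenheim–Skolem theorem with no lower bound on the structure. -/
theorem exists_elementarySubstructure_card_le {L : FirstOrder.Language.{u, v}} {M : Type w}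
    [L.Structure M] {s : Set M}
    (hs : Cardinal.lift.{max u v} (Cardinal.mk s) ≤
      Cardinal.lift.{w} (max Cardinal.aleph0 L.card)) :
    ∃ S : L.ElementarySubstructure M, s ⊆ S ∧
      Cardinal.lift.{max u v} (Cardinal.mk (S : Set M)) ≤
        Cardinal.lift.{w} (max Cardinal.aleph0 L.card) := by
  rcases le_total (Cardinal.lift.{w} (max Cardinal.aleph0 L.card))
    (Cardinal.lift.{max u v} (Cardinal.mk M)) with h | h
  · obtain ⟨S, hsS, hS⟩ := FirstOrder.Language.exists_elementarySubstructure_card_eq L s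
      (max Cardinal.aleph0 L.card) (le_max_left _ _) hs (by simp) h
    exact ⟨S, hsS, hS.le⟩
  · refine ⟨⊤, fun _ _ => trivial, le_trans ?_ h⟩
    exact Cardinal.lift_le.2 (Cardinal.mk_set_le _)

theorem card_formula_le {L : FirstOrder.Language.{u, v}} (α : Type) [Countable α] :
    Cardinal.mk (L.Formula α) ≤ max Cardinal.aleph0 L.card := by
  have hinj : Function.Injective fun φ : L.Formula α =>
      (⟨0, φ⟩ : Σ n, L.BoundedFormula α n) := fun φ ψ h => by simpa using h
  refine (Cardinal.mk_le_of_injective hinj).trans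
    (FirstOrder.Language.BoundedFormula.card_le.trans ?_)
  rw [Cardinal.lift_id'.{0, max u v}]
  refine max_le (le_max_left _ _) ((Cardinal.add_le_max _ _).trans ?_)
  refine max_le (max_le ?_ (le_max_right _ _)) (le_max_left _ _)
  exact (Cardinal.lift_le_aleph0.2 (Cardinal.mk_le_aleph0_iff.2 inferInstance)).trans (le_max_left _ _)

/-- There are at most `|L| + ℵ₀` entries in a family of finite tuples indexed by the formulas with
one distinguished variable and a natural number. -/
theorem card_sigma_formula_le {L : FirstOrder.Language.{u, v}}
    (n : (Σ m : ℕ, L.Formula (Unit ⊕ Fin m)) → ℕ → ℕ) :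
    Cardinal.mk (Σ (d : Σ m : ℕ, L.Formula (Unit ⊕ Fin m)) (N : ℕ), Fin (n d N)) ≤
      max Cardinal.aleph0 L.card := by
  set κ := max Cardinal.aleph0 L.card
  have hκ : Cardinal.aleph0 ≤ κ := le_max_left _ _
  have h1 : Cardinal.mk (Σ m : ℕ, L.Formula (Unit ⊕ Fin m)) ≤ κ := by
    rw [Cardinal.mk_sigma]
    refine (Cardinal.sum_le_sum _ (fun _ => κ) fun m => card_formula_le _).trans ?_
    rw [Cardinal.sum_const]
    refine Cardinal.mul_le_of_le hκ ?_ ?_ <;> simp [κ]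
  rw [Cardinal.mk_sigma]
  refine (Cardinal.sum_le_sum _ (fun _ => Cardinal.aleph0) fun d =>
    Cardinal.mk_le_aleph0_iff.2 inferInstance).trans ?_
  rw [Cardinal.sum_const]
  exact Cardinal.mul_le_of_le hκ (by simpa using h1) (by simpa using hκ)

theorem pseudofinite_counting_measure_on_ultraproduct
    {L : FirstOrder.Language.{u, v}} {ι : Type w} (𝒰 : Ultrafilter ι)
    (Mi : ι → Type x) [∀ i, L.Structure (Mi i)] [∀ i, Nonempty (Mi i)]
    (A : (i : ι) → Set (Mi i))
    (hfin : ∀ i, (A i).Finite) (hne : ∀ i, (A i).Nonempty) :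
    ∃ μ : Set ((↑𝒰 : Filter ι).Product Mi) → ℝ,
      -- (1) `μ` is a Keisler measure on `M*` over `M*` computing the
      -- `𝒰`-limit of the normalized counting measures on every definable set
      IsKeislerMeasureOn L ((↑𝒰 : Filter ι).Product Mi) Set.univ μ ∧
      (∀ (m : ℕ) (φ : L.Formula (Unit ⊕ Fin m))
          (b : Fin m → (↑𝒰 : Filter ι).Product Mi)
          (brep : (i : ι) → Fin m → Mi i),
        (∀ j, b j = ((fun i => brep i j : ∀ i, Mi i) : (↑𝒰 : Filter ι).Product Mi)) →
        Filter.Tendsto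
          (fun i : ι =>
            (Nat.card {a : Mi i // a ∈ A i ∧
                φ.Realize (Sum.elim (fun _ => a) (brep i))} : ℝ) /
              (Nat.card (A i) : ℝ))
          (↑𝒰 : Filter ι)
          (nhds (μ {a | φ.Realize (Sum.elim (fun _ => a) b)}))) ∧
      -- (2) if `Th(M*)` is NIP then `μ` is generically stable over a small model
      (TheoryIsNIP L ((↑𝒰 : Filter ι).Product Mi) →
        ∃ M₀ : L.ElementarySubstructure ((↑𝒰 : Filter ι).Product Mi),
          Cardinal.lift.{max u v} (Cardinal.mk (M₀ : Set ((↑𝒰 : Filter ι).Product Mi))) ≤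
            Cardinal.lift.{max w x} L.card + Cardinal.aleph0 ∧
          MeasureDefOver L ((↑𝒰 : Filter ι).Product Mi)
            (M₀ : Set ((↑𝒰 : Filter ι).Product Mi)) Set.univ μ ∧
          MeasureFinSatIn L ((↑𝒰 : Filter ι).Product Mi)
            (M₀ : Set ((↑𝒰 : Filter ι).Product Mi)) Set.univ μ) := by
  refine ⟨loebMeasure A, isKeislerMeasureOn_loebMeasure hfin hne, ?_, fun hNIP => ?_⟩
  · intro m φ b brep hb
    obtain rfl : b = fun j => toProduct 𝒰 fun i => brep i j :=
      funext hb
    exact (isInternal_formula (𝒰 := 𝒰) φ fun j i => brep i j).tendsto_loebMeasure hfin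
  · have happ := fun (d : Σ m : ℕ, L.Formula (Unit ⊕ Fin m)) (N : ℕ) =>
      exists_frequency_approx_loebMeasure (𝒰 := 𝒰) hfin hne hNIP d.2
        (Nat.one_div_pos_of_nat (α := ℝ) (n := N))
    choose n q hq using happ
    let P : Set ((↑𝒰 : Filter ι).Product Mi) :=
      Set.range fun z : Σ (d : Σ m : ℕ, L.Formula (Unit ⊕ Fin m)) (N : ℕ), Fin (n d N) =>
        q z.1 z.2.1 z.2.2
    obtain ⟨M₀, hPM, hcard⟩ := exists_elementarySubstructure_card_le (L := L) (s := P) 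
      (Cardinal.mk_range_le_lift.trans (Cardinal.lift_le.2 (card_sigma_formula_le n)))
    have happP : ∀ (m : ℕ) (φ : L.Formula (Unit ⊕ Fin m)) (ε : ℝ), 0 < ε →
        ∃ (n : ℕ) (q : Fin n → (↑𝒰 : Filter ι).Product Mi),
          (∀ j, q j ∈ (M₀ : Set ((↑𝒰 : Filter ι).Product Mi))) ∧
          ∀ b : Fin m → (↑𝒰 : Filter ι).Product Mi,
            |frequency q {a | φ.Realize (Sum.elim (fun _ => a) b)} -
              loebMeasure A {a | φ.Realize (Sum.elim (fun _ => a) b)}| ≤ ε := by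
      intro m φ ε hε
      obtain ⟨N, hN⟩ := exists_nat_one_div_lt hε
      exact ⟨_, q ⟨m, φ⟩ N, fun j => hPM ⟨⟨⟨m, φ⟩, N, j⟩, rfl⟩,
        fun b => (hq ⟨m, φ⟩ N b).trans hN.le⟩
    refine ⟨M₀, ?_, measureDefOver_of_frequency happP, measureFinSatIn_of_frequency happP⟩
    rw [Cardinal.lift_max, Cardinal.lift_aleph0] at hcard
    exact hcard.trans (max_le le_add_self le_self_add)
end

section
/- For every natural number k and every ε > 0 there is N ∈ ℕ such that for every finite bipartite graph (V, W, R) — V, W finite nonempty sets and R ⊆ V × W a k-stable relation — there are partitions V = V₁ ∪ … ∪ V_n and W = W₁ ∪ … ∪ W_m with n, m < N such that for all i ≤ n and j ≤ m: either |(V_i × W_j) ∩ R| ≤ ε·|V_i|·|W_j| (the induced subgraph on (V_i, W_j) is almost empty) or |(V_i × W_j) ∖ R| ≤ ε·|V_i|·|W_j| (the induced subgraph on (V_i, W_j) is almost complete). -/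
/-- There is a full binary tree of height `n` whose inner nodes are labelled by elements of `B` and
whose leaves are labelled by elements of `A`, such that a leaf lies on the left of an inner node
above it if and only if their labels are related by `R`. -/
def HasTree {X Y : Type*} (R : X → Y → Prop) : ℕ → Set X → Set Y → Prop
  | 0, A, _ => A.Nonempty
  | n + 1, A, B => ∃ b ∈ B, HasTree R n (A ∩ {x | R x b}) B ∧ HasTree R n (A ∩ {x | ¬R x b}) B

namespace HasTree

variable {X Y : Type*} {R : X → Y → Prop}

theorem mono {n : ℕ} {A A' : Set X} {B B' : Set Y} (h : HasTree R n A B) (hA : A ⊆ A')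
    (hB : B ⊆ B') : HasTree R n A' B' := by
  induction n generalizing A A' with
  | zero => exact Set.Nonempty.mono hA h
  | succ n ih =>
    obtain ⟨b, hb, h₁, h₂⟩ := h
    exact ⟨b, hB hb, ih h₁ (Set.inter_subset_inter_left _ hA),
      ih h₂ (Set.inter_subset_inter_left _ hA)⟩

theorem nonempty {n : ℕ} {A : Set X} {B : Set Y} (h : HasTree R n A B) : A.Nonempty := by
  induction n generalizing A with
  | zero => exact h
  | succ n ih =>
    obtain ⟨b, -, h, -⟩ := h
    exact (ih h).mono Set.inter_subset_left

/-- The Ramsey property of binary trees, for colourings of the inner nodes with two colours. -/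
theorem inter_or_inter_compl (C : Set Y) {m n : ℕ} {A : Set X} {B : Set Y}
    (h : HasTree R (m + n) A B) : HasTree R m A (B ∩ C) ∨ HasTree R n A (B ∩ Cᶜ) := by
  induction hs : m + n generalizing m n A with
  | zero =>
    obtain rfl : m = 0 := by omega
    exact Or.inl h.nonempty
  | succ s ih =>
    rw [hs] at h
    obtain ⟨b, hb, h₁, h₂⟩ := h
    by_cases hbC : b ∈ C
    · cases m with
      | zero => exact Or.inl (h₁.nonempty.mono Set.inter_subset_left)
      | succ m =>
        have hmn : m + n = s := by omega
        rcases ih (m := m) (n := n) (hmn ▸ h₁) hmn with h₁ | h₁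
        · rcases ih (m := m) (n := n) (hmn ▸ h₂) hmn with h₂ | h₂
          · exact Or.inl ⟨b, ⟨hb, hbC⟩, h₁, h₂⟩
          · exact Or.inr (h₂.mono Set.inter_subset_left subset_rfl)
        · exact Or.inr (h₁.mono Set.inter_subset_left subset_rfl)
    · cases n with
      | zero => exact Or.inr (h₁.nonempty.mono Set.inter_subset_left)
      | succ n =>
        have hmn : m + n = s := by omega
        rcases ih (m := m) (n := n) (hmn ▸ h₁) hmn with h₁ | h₁
        · exact Or.inl (h₁.mono Set.inter_subset_left subset_rfl)
        · rcases ih (m := m) (n := n) (hmn ▸ h₂) hmn with h₂ | h₂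
          · exact Or.inl (h₂.mono Set.inter_subset_left subset_rfl)
          · exact Or.inr ⟨b, ⟨hb, hbC⟩, h₁, h₂⟩

/-- A tree of height `2 ^ (k + 1) - 2` yields a half-graph of height `k`. -/
theorem exists_halfGraph (k : ℕ) {A : Set X} {B : Set Y} (h : HasTree R (2 * 2 ^ k - 2) A B) :
    ∃ (a : Fin k → X) (b : Fin k → Y),
      (∀ i, a i ∈ A) ∧ (∀ i, b i ∈ B) ∧ ∀ i j, R (a i) (b j) ↔ i ≤ j := by
  induction k generalizing A B with
  | zero => exact ⟨Fin.elim0, Fin.elim0, fun i => i.elim0, fun i => i.elim0, fun i => i.elim0⟩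
  | succ k ih =>
    have hk : 2 * 2 ^ (k + 1) - 2 = (2 * 2 ^ k - 2 + 1) + (2 * 2 ^ k - 2) + 1 := by
      have := Nat.one_le_two_pow (n := k)
      rw [pow_succ]
      omega
    rw [hk] at h
    obtain ⟨y, hy, h, -⟩ := h
    obtain ⟨x, hxA, hxy⟩ := h.nonempty
    rcases h.inter_or_inter_compl {y | R x y} with ⟨z, ⟨hz, hxz⟩, -, h⟩ | h
    · obtain ⟨a, b, ha, hb, hab⟩ := ih h
      refine ⟨Fin.cons x a, Fin.cons z b, ?_, ?_, ?_⟩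
      · exact Fin.cases hxA fun i => (ha i).1.1
      · exact Fin.cases hz fun i => (hb i).1
      · refine Fin.cases ?_ fun i => ?_ <;> refine Fin.cases ?_ fun j => ?_
        · simpa using hxz
        · simpa using (hb j).2
        · simpa using (ha i).2
        · simpa using hab i j
    · obtain ⟨a, b, ha, hb, hab⟩ := ih h
      refine ⟨Fin.snoc a x, Fin.snoc b y, ?_, ?_, ?_⟩
      · refine Fin.lastCases ?_ fun i => ?_
        · simpa using hxA
        · simpa using (ha i).1
      · refine Fin.lastCases ?_ fun i => ?_
        · simpa using hy
        · simpa using (hb i).1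
      · refine Fin.lastCases ?_ fun i => ?_ <;> refine Fin.lastCases ?_ fun j => ?_
        · simpa using hxy
        · simpa only [Fin.snoc_last, Fin.snoc_castSucc] using!
            iff_of_false (hb j).2 (Fin.castSucc_lt_last j).not_ge
        · simpa [Fin.le_def] using (ha i).2
        · simpa using hab i j

end HasTree

section Good

open Finset
open scoped Classical

variable {V W : Type*} {R : V → W → Prop}

/-- Every vertex `w` is related to almost all or to almost no elements of `A`. -/
def IsGood (R : V → W → Prop) (ε : ℝ) (A : Finset V) : Prop :=
  ∀ w, (#{v ∈ A | R v w} : ℝ) ≤ ε * #A ∨ (#{v ∈ A | ¬R v w} : ℝ) ≤ ε * #A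

theorem exists_isGood_subset_or_hasTree {ε : ℝ} (hε : 0 < ε) (hε1 : ε ≤ 1) (d : ℕ) {A : Finset V}
    (hA : A.Nonempty) :
    (∃ S ⊆ A, IsGood R ε S ∧ ε ^ d * #A ≤ #S) ∨ HasTree R d (A : Set V) Set.univ := by
  induction d generalizing A with
  | zero => exact Or.inr (by simpa [HasTree] using hA)
  | succ d ih =>
    refine or_iff_not_imp_left.2 fun hS => ?_
    have extend {A' : Finset V} (hA' : A' ⊆ A) (hcard : ε * #A < #A') :
        HasTree R d (A' : Set V) Set.univ := by
      have hpos : 0 < #A' := by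
        have : (0 : ℝ) < #A' := lt_of_le_of_lt (by positivity) hcard
        exact_mod_cast this
      refine (ih (card_pos.1 hpos)).resolve_left ?_
      rintro ⟨S, hSA, hgood, hle⟩
      refine hS ⟨S, hSA.trans hA', hgood, le_trans ?_ hle⟩
      rw [pow_succ, mul_assoc]
      gcongr
    by_cases hgood : IsGood R ε A
    · exact (hS ⟨A, subset_rfl, hgood,
        mul_le_of_le_one_left (by positivity) (pow_le_one₀ hε.le hε1)⟩).elim
    · simp only [IsGood, not_forall, not_or, not_le] at hgood
      obtain ⟨w, h₁, h₂⟩ := hgood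
      refine ⟨w, Set.mem_univ w, (extend (filter_subset _ _) h₁).mono ?_ subset_rfl,
        (extend (filter_subset _ _) h₂).mono ?_ subset_rfl⟩ <;> intro v <;> simp

theorem IsKStable.exists_isGood_subset {k : ℕ} (hR : IsKStable R k) {ε : ℝ} (hε : 0 < ε)
    (hε1 : ε ≤ 1) (A : Finset V) :
    ∃ S ⊆ A, IsGood R ε S ∧ ε ^ (2 * 2 ^ k - 2) * #A ≤ #S := by
  rcases A.eq_empty_or_nonempty with rfl | hA
  · exact ⟨∅, subset_rfl, fun w => by simp, by simp⟩
  · refine (exists_isGood_subset_or_hasTree hε hε1 _ hA).resolve_right fun h => hR ?_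
    obtain ⟨a, b, -, -, hab⟩ := h.exists_halfGraph
    exact ⟨a, b, hab⟩

/-- If every finite set has a good subset of density at least `δ`, then repeatedly splitting off
good subsets gives a partition into good sets and a small remainder. -/
theorem exists_coloring_isGood_of_ne [Fintype V] {ε δ : ℝ} (hδ1 : δ ≤ 1)
    (H : ∀ A : Finset V, ∃ S ⊆ A, IsGood R ε S ∧ δ * #A ≤ #S) (t : ℕ) :
    ∃ c : V → ℕ, (∀ v, c v ≤ t + 1) ∧ (∀ i < t + 1, IsGood R ε {v | c v = i}) ∧
      δ * Fintype.card V ≤ #{v | c v = 0} ∧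
      (#{v | c v = t + 1} : ℝ) ≤ (1 - δ) ^ t * Fintype.card V := by
  induction t with
  | zero =>
    obtain ⟨S, -, hS, hle⟩ := H univ
    refine ⟨fun v => if v ∈ S then 0 else 1, fun v => by beta_reduce; split_ifs <;> simp,
      fun i hi => ?_, by simpa using hle, ?_⟩
    · obtain rfl : i = 0 := by omega
      simpa using hS
    · simpa using card_le_univ _
  | succ t ih =>
    obtain ⟨c, hc, hgood, h0, hlast⟩ := ih
    obtain ⟨S, hSc, hS, hle⟩ := H {v | c v = t + 1}
    have hmem {v : V} (hv : v ∈ S) : c v = t + 1 := by simpa using hSc hv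
    obtain ⟨c', hc'⟩ : ∃ c' : V → ℕ, ∀ v, c' v = if c v = t + 1 ∧ v ∉ S then t + 2 else c v :=
      ⟨_, fun _ => rfl⟩
    have hold {i : ℕ} (hi : i < t + 1) :
        ({v | c' v = i} : Finset V) = ({v | c v = i} : Finset V) := by
      ext v
      simp only [mem_filter, mem_univ, true_and, hc']
      split_ifs <;> omega
    refine ⟨c', fun v => ?_, fun i hi => ?_, ?_, ?_⟩
    · have := hc v
      rw [hc']
      split_ifs <;> omega
    · rcases Nat.lt_succ_iff_lt_or_eq.1 hi with hi | rfl
      · rw [hold hi]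
        exact hgood i hi
      · convert hS using 1
        ext v
        simp only [mem_filter, mem_univ, true_and, hc']
        by_cases hv : v ∈ S
        · simp [hv, hmem hv]
        · simp only [hv, not_false_eq_true, and_true, iff_false]
          split_ifs <;> omega
    · rwa [hold (Nat.succ_pos t)]
    · have hrest : ({v | c' v = t + 1 + 1} : Finset V) = ({v | c v = t + 1} : Finset V) \ S := by
        ext v
        have := hc v
        simp only [mem_filter, mem_univ, true_and, mem_sdiff, hc']
        split_ifs with h
        · simpa using h
        · exact iff_of_false (by omega) h
      rw [hrest, cast_card_sdiff hSc, pow_succ, mul_right_comm]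
      have := mul_le_mul_of_nonneg_right hlast (sub_nonneg.2 hδ1)
      linarith

theorem IsGood.union {ε : ℝ} {A U : Finset V} (hε : 0 ≤ ε) (hA : IsGood R ε A)
    (hU : (#U : ℝ) ≤ ε * #A) : IsGood R (2 * ε) (A ∪ U) := by
  have key (p : V → Prop) [DecidablePred p] (h : (#{v ∈ A | p v} : ℝ) ≤ ε * #A) :
      (#{v ∈ A ∪ U | p v} : ℝ) ≤ 2 * ε * #(A ∪ U) := by
    have h₁ : #{v ∈ A ∪ U | p v} ≤ #{v ∈ A | p v} + #U := by
      rw [filter_union]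
      exact (card_union_le _ _).trans (Nat.add_le_add_left (card_le_card (filter_subset _ _)) _)
    have h₂ : #A ≤ #(A ∪ U) := card_le_card subset_union_left
    rify at h₁ h₂
    linarith [mul_le_mul_of_nonneg_left h₂ hε]
  exact fun w => (hA w).imp (key _) (key _)

theorem IsGood.mono {ε ε' : ℝ} {A : Finset V} (hA : IsGood R ε A) (h : ε ≤ ε') :
    IsGood R ε' A := by
  have key : ε * #A ≤ ε' * #A := by gcongr
  exact fun w => (hA w).imp key.trans' key.trans'

/-- The vertices of a `k`-stable bipartite graph can be partitioned into a bounded number of good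
sets. -/
theorem exists_coloring_isGood (k : ℕ) {ε : ℝ} (hε : 0 < ε) :
    ∃ n : ℕ, ∀ (V W : Type*) [Fintype V] (R : V → W → Prop), IsKStable R k →
      ∃ c : V → Fin n, ∀ i, IsGood R ε {v | c v = i} := by
  set η := min (ε / 2) (1 / 2)
  have hη : 0 < η := by positivity
  have hη1 : η < 1 := (min_le_right _ _).trans_lt (by norm_num)
  have hηε : 2 * η ≤ ε := by linarith [min_le_left (ε / 2) (1 / 2)]
  set δ := η ^ (2 * 2 ^ k - 2)
  have hδ : 0 < δ := by positivity
  have hδ1 : δ ≤ 1 := pow_le_one₀ hη.le hη1.le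
  obtain ⟨t, ht⟩ := exists_pow_lt_of_lt_one (mul_pos hη hδ) (sub_lt_self 1 hδ)
  refine ⟨t + 1, fun V W _ R hR => ?_⟩
  obtain ⟨c, hc, hgood, h0, hlast⟩ := exists_coloring_isGood_of_ne hδ1
    (hR.exists_isGood_subset hη hη1.le) t
  refine ⟨fun v => if h : c v < t + 1 then ⟨c v, h⟩ else 0, fun i => ?_⟩
  by_cases hi : i = 0
  · subst hi
    have hU : (#{v | c v = t + 1} : ℝ) ≤ η * #{v | c v = 0} := by
      have h₁ := mul_le_mul_of_nonneg_right ht.le (Nat.cast_nonneg (α := ℝ) (Fintype.card V))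
      have h₂ := mul_le_mul_of_nonneg_left h0 hη.le
      linarith
    convert ((hgood 0 t.succ_pos).union hη.le hU).mono hηε using 1
    ext v
    have := hc v
    simp only [mem_filter, mem_univ, true_and, mem_union]
    split_ifs with h
    · simp [Fin.ext_iff]
      omega
    · exact iff_of_true rfl (by omega)
  · convert (hgood i i.2).mono (ε' := ε) (by linarith) using 1
    ext v
    simp only [mem_filter, mem_univ, true_and]
    split_ifs with h
    · simp [Fin.ext_iff]
    · exact iff_of_false (Ne.symm hi) (by omega)

theorem card_filter_product_le {A : Finset V} {B : Finset W} {p : V → W → Prop}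
    [∀ v w, Decidable (p v w)] {r : ℝ}
    (h : ∀ w ∈ B, (#{v ∈ A | p v w} : ℝ) ≤ r) :
    (#{q ∈ A ×ˢ B | p q.1 q.2} : ℝ) ≤ r * #B := by
  have hcard : #{q ∈ A ×ˢ B | p q.1 q.2} = ∑ w ∈ B, #{v ∈ A | p v w} := by
    simp only [card_filter, sum_product_right]
  rw [hcard, Nat.cast_sum, mul_comm, ← nsmul_eq_mul]
  exact sum_le_card_nsmul _ _ _ h

end Good

theorem stable_regularity_lemma (k : ℕ) (ε : ℝ) (hε : 0 < ε) :
    ∃ N : ℕ, ∀ (V W : Type) [Finite V] [Finite W] [Nonempty V] [Nonempty W]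
      (R : V → W → Prop), IsKStable R k →
      ∃ (n m : ℕ), n < N ∧ m < N ∧
        ∃ (Vp : Fin n → Set V) (Wp : Fin m → Set W),
          (⋃ i, Vp i) = Set.univ ∧ Pairwise (Function.onFun Disjoint Vp) ∧
          (⋃ j, Wp j) = Set.univ ∧ Pairwise (Function.onFun Disjoint Wp) ∧
          ∀ (i : Fin n) (j : Fin m),
            (Nat.card {q : V × W // q.1 ∈ Vp i ∧ q.2 ∈ Wp j ∧ R q.1 q.2} : ℝ) ≤
                ε * (Nat.card (Vp i) : ℝ) * (Nat.card (Wp j) : ℝ) ∨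
            (Nat.card {q : V × W // q.1 ∈ Vp i ∧ q.2 ∈ Wp j ∧ ¬R q.1 q.2} : ℝ) ≤
                ε * (Nat.card (Vp i) : ℝ) * (Nat.card (Wp j) : ℝ) := by
  classical
  obtain ⟨n, hn⟩ := exists_coloring_isGood k hε
  refine ⟨max n (2 ^ n) + 1, fun V W _ _ _ _ R hR => ?_⟩
  have := Fintype.ofFinite V
  have := Fintype.ofFinite W
  obtain ⟨c, hc⟩ := hn V W R hR
  let e : (Fin n → Bool) ≃ Fin (2 ^ n) := Fintype.equivFinOfCardEq (by simp)
  let A (i : Fin n) : Finset V := {v | c v = i}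
  let s (w : W) (i : Fin n) : Bool :=
    decide ((({v ∈ A i | R v w} : Finset V).card : ℝ) ≤ ε * (A i).card)
  let B (j : Fin (2 ^ n)) : Finset W := {w | e (s w) = j}
  have hdisj {X Y : Type} (f : X → Y) :
      Pairwise (Function.onFun Disjoint fun y => {x | f x = y}) := fun y z hyz =>
    Set.disjoint_left.2 fun x hy hz => hyz (hy.symm.trans hz)
  have hcard (i : Fin n) (j : Fin (2 ^ n)) (p : V → W → Prop)
      (h : ∀ w ∈ B j, (({v ∈ A i | p v w} : Finset V).card : ℝ) ≤ ε * (A i).card) :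
      (Nat.card {q : V × W // q.1 ∈ {v | c v = i} ∧ q.2 ∈ {w | e (s w) = j} ∧ p q.1 q.2} : ℝ) ≤
        ε * (Nat.card {v | c v = i} : ℝ) * (Nat.card {w | e (s w) = j} : ℝ) := by
    convert card_filter_product_le h using 2
    · rw [Nat.card_eq_fintype_card, Fintype.card_subtype]
      congr 1
      ext q
      simp [A, B, and_assoc]
    · rw [Nat.card_eq_fintype_card, ← Set.toFinset_card]
      congr 3
      ext v
      simp [A]
    · rw [Nat.card_eq_fintype_card, ← Set.toFinset_card]
      congr 2
      ext w
      simp [B]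
  refine ⟨n, 2 ^ n, by omega, by omega, fun i => {v | c v = i}, fun j => {w | e (s w) = j},
    Set.iUnion_eq_univ_iff.2 fun v => ⟨c v, rfl⟩, hdisj c,
    Set.iUnion_eq_univ_iff.2 fun w => ⟨e (s w), rfl⟩, hdisj fun w => e (s w), fun i j => ?_⟩
  have hs {w : W} (hw : w ∈ B j) : s w i = e.symm j i := by
    have : e (s w) = j := by simpa [B] using hw
    rw [← this, e.symm_apply_apply]
  cases hj : e.symm j i
  · refine Or.inr (hcard i j (fun v w => ¬R v w) fun w hw => ?_)
    have hle := (hc i w).resolve_left fun h => ?_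
    · convert hle
    · refine of_decide_eq_false ((hs hw).trans hj) ?_
      convert h
  · exact Or.inl (hcard i j R fun w hw => of_decide_eq_true ((hs hw).trans hj))
end
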